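/- arXiv:2106.08430 — 6 statements merged into one kernel-verified Lean document; each statement's English description precedes it below -/
import Mathlib

section
/- Every subdivided caterpillar admits an antimagic orientation. -/
/-- The oriented vertex-sum of a vertex `v` in an orientation of `G` given by a
head-choice function `head` (the endpoint each edge points to), under an integer
labeling `lab` of the edges: the sum of the labels of arcs entering `v` minus the
sum of the labels of arcs leaving `v`. -/
def orientedVertexSum {V : Type*} [DecidableEq V] (G : SimpleGraph V)
    [Fintype G.edgeSet] (head : G.edgeSet → V) (lab : G.edgeSet → ℤ) (v : V) : ℤ :=
  ∑ e : G.edgeSet, if head e = v then lab e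
    else if v ∈ (e : Sym2 V) then -lab e else 0

/-- A graph `G` with `m` edges admits an antimagic orientation: there is an orientation
(a choice of head, among the two endpoints, for each edge) and a bijective labeling of
the arcs by `{1, …, m}` such that no two distinct vertices have the same vertex-sum. -/
def HasAntimagicOrientation {V : Type*} [DecidableEq V] (G : SimpleGraph V)
    [Fintype G.edgeSet] : Prop :=
  ∃ (head : G.edgeSet → V) (lab : G.edgeSet → ℤ),
    (∀ e : G.edgeSet, head e ∈ (e : Sym2 V)) ∧
    Set.BijOn lab Set.univ (Set.Icc 1 (G.edgeFinset.card : ℤ)) ∧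
    Function.Injective (orientedVertexSum G head lab)

/-- The subdivided caterpillar with spine `v_0 v_1 ⋯ v_p`, and `s` legs each of
length `k`, the `i`-th leg being the path `x_{i 0} x_{i 1} ⋯ x_{i (k-1)}` attached to
the spine vertex `v_{attach i}` (so each leg, including its attaching edge, is a path
of length `k` hanging from a spine vertex). -/
def subdividedCaterpillar (p s k : ℕ) (attach : Fin s → Fin (p + 1)) :
    SimpleGraph (Fin (p + 1) ⊕ Fin s × Fin k) :=
  SimpleGraph.fromRel (fun a b =>
    match a, b with
    | Sum.inl i, Sum.inl i' => (i : ℕ) + 1 = (i' : ℕ)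
    | Sum.inl i, Sum.inr (l, j) => i = attach l ∧ (j : ℕ) = 0
    | Sum.inr (l, j), Sum.inr (l', j') => l = l' ∧ (j : ℕ) + 1 = (j' : ℕ)
    | _, _ => False)


lemma zigzag {α β : Type*} [DecidableEq α] [LinearOrder β] (Ω : Finset α) (t : α → β)
    (ht : ∀ u ∈ Ω, ∀ v ∈ Ω, t u = t v → u = v) (hi : α → Prop) [DecidablePred hi] :
    ∃ F : α → ℤ, (∀ u ∈ Ω, 1 ≤ F u ∧ F u ≤ Ω.card) ∧
      (∀ u ∈ Ω, ∀ v ∈ Ω, hi u → hi v → t u < t v → F v < F u) ∧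
      (∀ u ∈ Ω, ∀ v ∈ Ω, ¬ hi u → ¬ hi v → t u < t v → F u < F v) ∧
      (∀ u ∈ Ω, ∀ v ∈ Ω, hi u → ¬ hi v → F v < F u) ∧
      (∀ u ∈ Ω, ∀ v ∈ Ω, F u = F v → u = v) := by
  classical
  let A : α → Finset α := fun u => Ω.filter (fun w => hi w ∧ t w < t u)
  let B : α → Finset α := fun u => Ω.filter (fun w => ¬ hi w ∧ t w < t u)
  let F : α → ℤ := fun u => if hi u then (Ω.card : ℤ) - (A u).card else 1 + (B u).card
  have hc : (Ω.filter hi).card + (Ω.filter (fun w => ¬ hi w)).card = Ω.card :=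
    Finset.card_filter_add_card_filter_not (s := Ω) hi
  have hA : ∀ u ∈ Ω, hi u → (A u).card < (Ω.filter hi).card := by
    intro u hu h
    apply Finset.card_lt_card
    rw [Finset.ssubset_iff_of_subset]
    · exact ⟨u, by simp [hu, h], by simp [A]⟩
    · intro w; simp only [A, Finset.mem_filter]; tauto
  have hB : ∀ u ∈ Ω, ¬ hi u → (B u).card < (Ω.filter (fun w => ¬ hi w)).card := by
    intro u hu h
    apply Finset.card_lt_card
    rw [Finset.ssubset_iff_of_subset]
    · exact ⟨u, by simp [hu, h], by simp [B]⟩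
    · intro w; simp only [B, Finset.mem_filter]; tauto
  have hAA : ∀ u ∈ Ω, ∀ v ∈ Ω, hi u → hi v → t u < t v → F v < F u := by
    intro u hu v hv h h' hlt
    have : (A u).card < (A v).card := by
      apply Finset.card_lt_card
      rw [Finset.ssubset_iff_of_subset]
      · exact ⟨u, by simp [A, hu, h, hlt], by simp [A]⟩
      · intro w; simp only [A, Finset.mem_filter]
        rintro ⟨a, b, c⟩; exact ⟨a, b, c.trans hlt⟩
    simp only [F, h, h', if_true]; omega
  have hBB : ∀ u ∈ Ω, ∀ v ∈ Ω, ¬ hi u → ¬ hi v → t u < t v → F u < F v := by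
    intro u hu v hv h h' hlt
    have : (B u).card < (B v).card := by
      apply Finset.card_lt_card
      rw [Finset.ssubset_iff_of_subset]
      · exact ⟨u, by simp [B, hu, h, hlt], by simp [B]⟩
      · intro w; simp only [B, Finset.mem_filter]
        rintro ⟨a, b, c⟩; exact ⟨a, b, c.trans hlt⟩
    simp only [F, h, h', if_false]; omega
  have hAB : ∀ u ∈ Ω, ∀ v ∈ Ω, hi u → ¬ hi v → F v < F u := by
    intro u hu v hv h h'
    have h1 := hA u hu h
    have h2 := hB v hv h'
    simp only [F, h, h', if_true, if_false]; omega
  refine ⟨F, ?_, hAA, hBB, hAB, ?_⟩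
  · intro u hu
    by_cases h : hi u
    · have h1 := hA u hu h
      simp only [F, h, if_true]; omega
    · have h1 := hB u hu h
      simp only [F, h, if_false]; omega
  · intro u hu v hv he
    by_contra hne
    have htne : t u ≠ t v := fun h => hne (ht u hu v hv h)
    by_cases h : hi u <;> by_cases h' : hi v
    · rcases lt_or_gt_of_ne htne with hl | hl
      · have := hAA u hu v hv h h' hl; omega
      · have := hAA v hv u hu h' h hl; omega
    · have := hAB u hu v hv h h'; omega
    · have := hAB v hv u hu h' h; omega
    · rcases lt_or_gt_of_ne htne with hl | hl
      · have := hBB u hu v hv h h' hl; omega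
      · have := hBB v hv u hu h' h hl; omega

lemma tree_lemma {V W : Type*} [DecidableEq V] [Fintype W] [DecidableEq W] (G : SimpleGraph V)
    [Fintype G.edgeSet] (φ : W ≃ V) (r : W) (par : W → W)
    (hadj : ∀ x y : W, G.Adj (φ x) (φ y) ↔ (x ≠ r ∧ par x = y) ∨ (y ≠ r ∧ par y = x))
    (h2 : ∀ x, x ≠ r → par x ≠ r → par (par x) ≠ x)
    (g : W → ℤ) (hinj : ∀ x y, x ≠ r → y ≠ r → |g x| = |g y| → x = y)
    (hpos : ∀ x, x ≠ r → 1 ≤ |g x| ∧ |g x| ≤ (Fintype.card W : ℤ) - 1)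
    (hr : g r = 0)
    (hS : Function.Injective
      (fun v : W => (∑ u, if u ≠ r ∧ par u = v then g u else 0) - g v)) :
    HasAntimagicOrientation G := by
  classical
  let ef : {x : W // x ≠ r} → G.edgeSet := fun x =>
    ⟨s(φ x, φ (par x)), by
      rw [SimpleGraph.mem_edgeSet, hadj]; exact Or.inl ⟨x.2, rfl⟩⟩
  have hef : Function.Bijective ef := by
    constructor
    · rintro ⟨x, hx⟩ ⟨y, hy⟩ h
      have h' : s(φ x, φ (par x)) = s(φ y, φ (par y)) := congrArg Subtype.val h
      rw [Sym2.eq_iff] at h'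
      simp only [EmbeddingLike.apply_eq_iff_eq] at h'
      rcases h' with h' | h'
      · exact Subtype.ext h'.1
      · exfalso
        apply h2 x hx
        · rw [h'.2]; exact hy
        · rw [h'.2]; exact h'.1.symm
    · rintro ⟨e, he⟩
      induction e using Sym2.ind with
      | _ a b =>
        obtain ⟨x, rfl⟩ := φ.surjective a
        obtain ⟨y, rfl⟩ := φ.surjective b
        have he' := he
        rw [SimpleGraph.mem_edgeSet, hadj] at he'
        rcases he' with ⟨hx, hp⟩ | ⟨hy, hp⟩
        · exact ⟨⟨x, hx⟩, Subtype.ext (by simp [ef, hp])⟩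
        · exact ⟨⟨y, hy⟩, Subtype.ext (by simp [ef, hp, Sym2.eq_swap])⟩
  let e : {x : W // x ≠ r} ≃ G.edgeSet := Equiv.ofBijective ef hef
  have hcard : (G.edgeFinset.card : ℤ) = (Fintype.card W : ℤ) - 1 := by
    rw [SimpleGraph.edgeFinset_card, ← Fintype.card_congr e]
    have h1 := Fintype.card_subtype_compl (fun x : W => x = r)
    have h3 : 0 < Fintype.card W := Fintype.card_pos_iff.mpr ⟨r⟩
    rw [Fintype.card_subtype_eq] at h1
    have : Fintype.card {x : W // x ≠ r} = Fintype.card W - 1 := h1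
    omega
  have hnl : ∀ x, x ≠ r → par x ≠ x := by
    intro x hx hp
    exact G.loopless.irrefl (φ x) ((hadj x x).2 (Or.inl ⟨hx, hp⟩))
  let hd : {x : W // x ≠ r} → W := fun x => if 0 < g x then par x else x
  refine ⟨fun d => φ (hd (e.symm d)), fun d => |g (e.symm d)|, ?_, ?_, ?_⟩
  · intro d
    obtain ⟨x, rfl⟩ := e.surjective d
    simp only [Equiv.symm_apply_apply]
    show φ (hd x) ∈ s(φ x, φ (par x))
    simp only [hd]; split_ifs <;> simp
  · have hmaps : Set.MapsTo (fun d => |g (e.symm d)|) Set.univ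
        (Set.Icc 1 (G.edgeFinset.card : ℤ)) := by
      intro d _
      rw [hcard]
      exact hpos _ (e.symm d).2
    have hi : Set.InjOn (fun d => |g (e.symm d)|) Set.univ := by
      intro d _ d' _ h
      exact e.symm.injective (Subtype.ext (hinj _ _ (e.symm d).2 (e.symm d').2 h))
    refine ⟨hmaps, hi, ?_⟩
    have := Finset.surjOn_of_injOn_of_card_le (s := (Finset.univ : Finset G.edgeSet))
      (t := Finset.Icc (1 : ℤ) (G.edgeFinset.card : ℤ)) (fun d => |g (e.symm d)|)
      (by simpa using hmaps) (by simpa using hi)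
      (by rw [Int.card_Icc, Finset.card_univ, SimpleGraph.edgeFinset_card]; simp)
    simpa using this
  · have key : ∀ w : W, orientedVertexSum G (fun d => φ (hd (e.symm d)))
        (fun d => |g (e.symm d)|) (φ w) =
        (∑ u, if u ≠ r ∧ par u = w then g u else 0) - g w := by
      intro w
      unfold orientedVertexSum
      rw [← e.sum_comp]
      have hterm : ∀ x : {x : W // x ≠ r},
          (if φ (hd (e.symm (e x))) = φ w then |g (e.symm (e x))|
            else if φ w ∈ ((e x : G.edgeSet) : Sym2 V) then -|g (e.symm (e x))| else 0)
          = (if par x = w then g x else 0) - (if (x : W) = w then g x else 0) := by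
        intro x
        simp only [Equiv.symm_apply_apply, EmbeddingLike.apply_eq_iff_eq]
        have hm : φ w ∈ ((e x : G.edgeSet) : Sym2 V) ↔ (w = x ∨ w = par x) := by
          show φ w ∈ s(φ x, φ (par x)) ↔ _
          simp
        have h1 := hnl x x.2
        rw [if_congr hm rfl rfl]
        simp only [hd]
        rcases lt_or_ge 0 (g x) with h | h
        · simp only [if_pos h, abs_of_pos h]
          by_cases ha : par x = w
          · have : (x : W) ≠ w := by rw [← ha]; exact h1.symm
            simp [ha, this]
          · by_cases hb : (x : W) = w
            · have h3 : par w ≠ w := by rw [← hb]; exact h1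
              simp [hb, h3]
            · simp [ha, hb, Ne.symm ha, Ne.symm hb]
        · simp only [if_neg (not_lt.2 h), abs_of_nonpos h]
          by_cases ha : par x = w
          · have : (x : W) ≠ w := by rw [← ha]; exact h1.symm
            simp [ha, this]
          · by_cases hb : (x : W) = w
            · have h3 : par w ≠ w := by rw [← hb]; exact h1
              simp [hb, h3]
            · simp [ha, hb, Ne.symm ha, Ne.symm hb]
      rw [Finset.sum_congr rfl (fun x _ => hterm x), Finset.sum_sub_distrib]
      congr 1
      · rw [← Finset.sum_subtype (Finset.univ.filter (· ≠ r)) (by simp)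
          (fun x => if par x = w then g x else 0), Finset.sum_filter]
        refine Finset.sum_congr rfl fun u _ => ?_
        rw [ite_and]
      · rw [← Finset.sum_subtype (Finset.univ.filter (· ≠ r)) (by simp)
          (fun x => if x = w then g x else 0), Finset.sum_filter, Finset.sum_eq_single w]
        · by_cases hw : w = r
          · simp [hw, hr]
          · simp [hw]
        · intro b _ hb; simp [hb]
        · simp
    intro a b hab
    obtain ⟨x, rfl⟩ := φ.surjective a
    obtain ⟨y, rfl⟩ := φ.surjective b
    rw [key, key] at hab
    rw [hS hab]


def cSide (N : ℕ → Prop) [DecidablePred N] : ℕ → Bool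
  | 0 => false
  | c + 1 => if N c then false else !(cSide N c)

def cNxt {n : ℕ} : ℕ ⊕ (Σ _ : Fin n, ℕ) → ℕ ⊕ (Σ _ : Fin n, ℕ)
  | Sum.inl c => Sum.inl (c + 1)
  | Sum.inr x => Sum.inr ⟨x.1, x.2 + 1⟩

def cMem (P : ℕ) {n : ℕ} (slen : Fin n → ℕ) : ℕ ⊕ (Σ _ : Fin n, ℕ) → Prop
  | Sum.inl c => 1 ≤ c ∧ c ≤ P
  | Sum.inr x => 1 ≤ x.2 ∧ x.2 < slen x.1

def cZ (N : ℕ → Prop) {n : ℕ} : ℕ ⊕ (Σ _ : Fin n, ℕ) → Prop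
  | Sum.inl c => ¬ N c
  | Sum.inr _ => True

lemma lemC1 (P n : ℕ) (slen : Fin n → ℕ) (h1 : ∀ l, 1 ≤ slen l)
    (hsort : ∀ l l', l < l' → (slen l % 2 = 1 ∧ slen l' % 2 = 1 ∧ slen l ≤ slen l') ∨
      (slen l % 2 = 1 ∧ slen l' % 2 = 0) ∨
      (slen l % 2 = 0 ∧ slen l' % 2 = 0 ∧ slen l' ≤ slen l))
    (N : ℕ → Prop) [DecidablePred N] :
    ∃ F : ℕ ⊕ (Σ _ : Fin n, ℕ) → ℤ,
      (∀ v, cMem P slen v → 1 ≤ F v ∧ F v ≤ ((P + ∑ l, (slen l - 1) : ℕ) : ℤ)) ∧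
      (∀ v w, cMem P slen v → cMem P slen w → F v = F w → v = w) ∧
      (∀ c, 1 ≤ c → c + 1 ≤ P → N c → F (Sum.inl (c + 1)) < F (Sum.inl c)) ∧
      (∀ v w, cMem P slen v → cMem P slen (cNxt v) → cZ N v →
        cMem P slen w → cMem P slen (cNxt w) → cZ N w →
        F v - F (cNxt v) = F w - F (cNxt w) → v = w) ∧
      (∀ v, cMem P slen v → cMem P slen (cNxt v) → cZ N v →
        ∀ l i, 1 ≤ i → i + 1 = slen l → F v - F (cNxt v) ≠ F (Sum.inr ⟨l, i⟩)) ∧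
      (∀ l l', l < l' → (if 1 < slen l then F (Sum.inr ⟨l, 1⟩) else 0) ≤
        (if 1 < slen l' then F (Sum.inr ⟨l', 1⟩) else 0)) := by
  classical
  let Ω : Finset (ℕ ⊕ (Σ _ : Fin n, ℕ)) :=
    (Finset.Icc 1 P).disjSum (Finset.univ.sigma fun l : Fin n => Finset.Ico 1 (slen l))
  have hΩ : ∀ v, v ∈ Ω ↔ cMem P slen v := by
    rintro (c | ⟨l, i⟩) <;> simp [Ω, cMem]
  have hcard : Ω.card = P + ∑ l, (slen l - 1) := by
    simp [Ω]
  let C : ℕ := ∑ l, slen l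
  have hC : ∀ l, slen l ≤ C := fun l =>
    Finset.single_le_sum (f := slen) (fun _ _ => Nat.zero_le _) (Finset.mem_univ l)
  let t : ℕ ⊕ (Σ _ : Fin n, ℕ) → ℤ ×ₗ ℤ := fun v => match v with
    | Sum.inl c => toLex ((C : ℤ), -(c : ℤ))
    | Sum.inr x => toLex ((slen x.1 : ℤ) - 1 - x.2,
        if slen x.1 % 2 = 1 then (x.1 : ℤ) else 2 * n - 1 - (x.1 : ℤ))
  let hi : ℕ ⊕ (Σ _ : Fin n, ℕ) → Prop := fun v => match v with
    | Sum.inl c => cSide N c = true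
    | Sum.inr x => (slen x.1 - 1 - x.2) % 2 = 0
  have ht : ∀ u ∈ Ω, ∀ v ∈ Ω, t u = t v → u = v := by
    rintro (c | ⟨l, i⟩) hu (c' | ⟨l', i'⟩) hv h <;> rw [hΩ] at hu hv <;>
      simp only [cMem, t, EmbeddingLike.apply_eq_iff_eq, Prod.mk.injEq] at hu hv h
    · congr 1; omega
    · have := hC l'; omega
    · have := hC l; omega
    · have hl := l.2
      have hl' := l'.2
      have : l = l' := by
        apply Fin.ext
        split_ifs at h <;> omega
      subst this
      have : i = i' := by omega
      subst this; rfl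
  obtain ⟨F, hF1, hHH, hLL, hHL, hFi⟩ := zigzag Ω t ht hi
  have hnt : ∀ v, cMem P slen v → cMem P slen (cNxt v) → t (cNxt v) < t v := by
    rintro (c | ⟨l, i⟩) hv hv' <;>
      simp only [cMem, t, cNxt, Prod.Lex.toLex_lt_toLex] at hv hv' ⊢ <;> push_cast
    · exact Or.inr ⟨trivial, by omega⟩
    · left; omega
  have hnn : ∀ v w, cMem P slen v → cMem P slen (cNxt v) → cMem P slen w →
      cMem P slen (cNxt w) → t v < t w → t (cNxt v) < t (cNxt w) := by
    rintro (c | ⟨l, i⟩) (c' | ⟨l', i'⟩) hv hv' hw hw' h <;>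
      simp only [cMem, t, cNxt, Prod.Lex.toLex_lt_toLex] at hv hv' hw hw' h ⊢ <;>
      push_cast
    · simp only [lt_irrefl, true_and, false_or] at h ⊢
      omega
    · have := hC l'; omega
    · have := hC l; omega
    · rcases h with h | ⟨h, h'⟩
      · left; omega
      · right; exact ⟨by omega, h'⟩
  have hop : ∀ v, cMem P slen v → cMem P slen (cNxt v) → cZ N v → (hi (cNxt v) ↔ ¬ hi v) := by
    rintro (c | ⟨l, i⟩) hv hv' hz <;> simp only [cMem, hi, cNxt, cZ] at hv hv' hz ⊢
    · simp [cSide, hz]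
    · omega
  simp only [hΩ] at hF1 hHH hLL hHL hFi
  rw [hcard] at hF1
  have hsgn : ∀ v, cMem P slen v → cMem P slen (cNxt v) → cZ N v →
      (hi v ∧ 0 < F v - F (cNxt v)) ∨ (¬ hi v ∧ F v - F (cNxt v) < 0) := by
    intro v h h' hz
    by_cases hh : hi v
    · have := hHL v h (cNxt v) h' hh (by rw [hop v h h' hz]; simpa using hh)
      left; exact ⟨hh, by omega⟩
    · have := hHL (cNxt v) h' v h (by rw [hop v h h' hz]; simpa using hh) hh
      right; exact ⟨hh, by omega⟩
  have hlt : ∀ v w, cMem P slen v → cMem P slen (cNxt v) → cZ N v →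
        cMem P slen w → cMem P slen (cNxt w) → cZ N w → t v < t w →
        F v - F (cNxt v) ≠ F w - F (cNxt w) := by
    intro v w hv hv' hz hw hw' hz' h
    have hd := hnn v w hv hv' hw hw' h
    have ov := hop v hv hv' hz
    have ow := hop w hw hw' hz'
    rcases hsgn v hv hv' hz with ⟨a, b⟩ | ⟨a, b⟩ <;> rcases hsgn w hw hw' hz' with ⟨a', b'⟩ | ⟨a', b'⟩
    · have e1 := hHH v hv w hw a a' h
      have e2 := hLL _ hv' _ hw' (by tauto) (by tauto) hd
      omega
    · omega
    · omega
    · have e1 := hLL v hv w hw a a' h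
      have e2 := hHH _ hv' _ hw' (by tauto) (by tauto) hd
      omega
  refine ⟨F, hF1, fun v w hv hw => hFi v hv w hw, ?_, ?_, ?_, ?_⟩
  · intro c hc hc' hN
    have m1 : cMem P slen (Sum.inl c) := ⟨hc, by omega⟩
    have m2 : cMem P slen (cNxt (Sum.inl c)) := ⟨by omega, by omega⟩
    have hl : ¬ hi (cNxt (Sum.inl c)) := by simp [hi, cNxt, cSide, hN]
    by_cases hh : hi (Sum.inl c)
    · exact hHL _ m1 _ m2 hh hl
    · exact hLL _ m2 _ m1 hl hh (hnt _ m1 m2)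
  · intro v w hv hv' hz hw hw' hz' he
    rcases lt_trichotomy (t v) (t w) with h | h | h
    · exact absurd he (hlt v w hv hv' hz hw hw' hz' h)
    · exact ht v ((hΩ v).2 hv) w ((hΩ w).2 hw) h
    · exact absurd he.symm (hlt w v hw hw' hz' hv hv' hz h)
  · intro v hv hv' hz l i hi1 hi2
    have m : cMem P slen (Sum.inr ⟨l, i⟩) := ⟨hi1, by show i < slen l; omega⟩
    have p1 := hF1 _ m
    have p2 := hF1 _ hv'
    rcases hsgn v hv hv' hz with ⟨a, b⟩ | ⟨a, b⟩
    · have hlf : hi (Sum.inr ⟨l, i⟩) := by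
        show (slen l - 1 - i) % 2 = 0
        omega
      have : t (Sum.inr ⟨l, i⟩) < t v := by
        rcases v with c | ⟨l', i'⟩ <;>
          simp only [cMem, t, cNxt, Prod.Lex.toLex_lt_toLex] at hv hv' ⊢
        · have := hC l; omega
        · left; omega
      have := hHH _ m _ hv hlf a this
      omega
    · omega
  · intro l l' hll
    have hs := hsort l l' hll
    have b1 := h1 l
    have b2 := h1 l'
    have hl := l.2
    have hl' := l'.2
    have hll' : (l : ℕ) < l' := hll
    by_cases c1 : 1 < slen l
    · have c2 : 1 < slen l' := by omega
      have m : cMem P slen (Sum.inr ⟨l, 1⟩) := ⟨le_refl _, c1⟩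
      have m' : cMem P slen (Sum.inr ⟨l', 1⟩) := ⟨le_refl _, c2⟩
      rw [if_pos c1, if_pos c2]
      apply le_of_lt
      rcases hs with ⟨a, b, c⟩ | ⟨a, b⟩ | ⟨a, b, c⟩
      · apply hLL _ m _ m'
        · show ¬ ((slen l - 1 - 1) % 2 = 0); omega
        · show ¬ ((slen l' - 1 - 1) % 2 = 0); omega
        · simp only [t, Prod.Lex.toLex_lt_toLex, a, b, if_true]; omega
      · apply hHL _ m' _ m
        · show ((slen l' - 1 - 1) % 2 = 0); omega
        · show ¬ ((slen l - 1 - 1) % 2 = 0); omega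
      · apply hHH _ m' _ m
        · show ((slen l' - 1 - 1) % 2 = 0); omega
        · show ((slen l - 1 - 1) % 2 = 0); omega
        · simp only [t, Prod.Lex.toLex_lt_toLex, a, b]; norm_num; omega
    · rw [if_neg c1]
      split_ifs with c2
      · have m' : cMem P slen (Sum.inr ⟨l', 1⟩) := ⟨le_refl _, c2⟩
        have := hF1 _ m'
        omega
      · exact le_refl _


lemma sort_slots {Λ : Type*} [Fintype Λ] (len : Λ → ℕ) :
    ∃ (slen : Fin (Fintype.card Λ) → ℕ) (σ : Λ ≃ Fin (Fintype.card Λ)),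
      (∀ l, slen (σ l) = len l) ∧
      (∀ l l', l < l' → (slen l % 2 = 1 ∧ slen l' % 2 = 1 ∧ slen l ≤ slen l') ∨
        (slen l % 2 = 1 ∧ slen l' % 2 = 0) ∨
        (slen l % 2 = 0 ∧ slen l' % 2 = 0 ∧ slen l' ≤ slen l)) := by
  classical
  let C : ℕ := 1 + ∑ l, len l
  have hC : ∀ l, len l < C := fun l => by
    have := Finset.single_le_sum (f := len) (fun _ _ => Nat.zero_le _) (Finset.mem_univ l)
    omega
  let e := Fintype.equivFin Λ
  let f : Fin (Fintype.card Λ) → ℤ := fun j =>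
    if len (e.symm j) % 2 = 1 then (len (e.symm j) : ℤ) - C else C - len (e.symm j)
  obtain ⟨π, hm⟩ : ∃ π : Equiv.Perm (Fin (Fintype.card Λ)), Monotone (f ∘ π) :=
    ⟨_, Tuple.monotone_sort f⟩
  refine ⟨fun j => len (e.symm (π j)), e.trans π.symm, ?_, ?_⟩
  · intro l; simp
  · intro l l' h
    have h1 := hm h.le
    simp only [Function.comp, f] at h1
    have a := hC (e.symm (π l))
    have b := hC (e.symm (π l'))
    dsimp only
    split_ifs at h1 <;> omega

lemma max_assign {Λ κ : Type*} [Fintype Λ] [DecidableEq Λ] [Fintype κ] [DecidableEq κ] (len : Λ → ℕ)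
    (slen : Fin (Fintype.card Λ) → ℕ) (σ₀ : Λ ≃ Fin (Fintype.card Λ))
    (h0 : ∀ l, slen (σ₀ l) = len l) (att : Λ → κ) (base : κ → ℤ) (m : ℤ)
    (H1 : ∀ l l', att l ≠ att l' → ∃ a a', att a = att l ∧ att a' = att l' ∧ len a = len a') :
    ∃ σ : Λ ≃ Fin (Fintype.card Λ), (∀ l, slen (σ l) = len l) ∧
      ∀ l l', att l ≠ att l' →
        (base (att l) + ∑ x, if att x = att l then ((σ x : ℕ) : ℤ) + m else 0) ≠
        (base (att l') + ∑ x, if att x = att l' then ((σ x : ℕ) : ℤ) + m else 0) := by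
  let A : (Λ ≃ Fin (Fintype.card Λ)) → κ → ℤ := fun σ c =>
    base c + ∑ x, if att x = c then ((σ x : ℕ) : ℤ) + m else 0
  obtain ⟨σ, hσ, hmax⟩ := Finset.exists_max_image
    (Finset.univ.filter fun σ : Λ ≃ Fin (Fintype.card Λ) => ∀ l, slen (σ l) = len l)
    (fun σ => ∑ c, (A σ c) ^ 2) ⟨σ₀, by simpa using h0⟩
  simp only [Finset.mem_filter, Finset.mem_univ, true_and] at hσ hmax
  refine ⟨σ, hσ, ?_⟩
  intro l₀ l₀' hne heq
  obtain ⟨a, a', ha, ha', hlen⟩ := H1 l₀ l₀' hne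
  rw [← ha, ← ha'] at heq hne
  change A σ (att a) = A σ (att a') at heq
  have haa : a ≠ a' := fun h => hne (by rw [h])
  let τ := (Equiv.swap a a').trans σ
  have hτ : ∀ l, slen (τ l) = len l := by
    intro l
    simp only [τ, Equiv.trans_apply, hσ]
    by_cases h1 : l = a
    · subst h1; simp [hlen]
    · by_cases h2 : l = a'
      · subst h2; simp [hlen]
      · rw [Equiv.swap_apply_of_ne_of_ne h1 h2]
  have hle := hmax τ hτ
  set d : ℤ := ((σ a' : ℕ) : ℤ) - ((σ a : ℕ) : ℤ) with hd
  have hd0 : d ≠ 0 := by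
    intro h
    apply haa
    apply σ.injective
    apply Fin.ext
    omega
  have hA : ∀ c, A τ c = A σ c + ((if c = att a then d else 0) + (if c = att a' then -d else 0)) := by
    intro c
    have : ∀ x, (if att x = c then ((τ x : ℕ) : ℤ) + m else 0) =
        (if att x = c then ((σ x : ℕ) : ℤ) + m else 0) +
        ((if x = a then (if c = att a then d else 0) else 0) +
         (if x = a' then (if c = att a' then -d else 0) else 0)) := by
      intro x
      by_cases h1 : x = a
      · subst h1
        simp only [τ, Equiv.trans_apply, Equiv.swap_apply_left, if_true, if_neg haa, eq_comm (a := c)]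
        split_ifs <;> omega
      · by_cases h2 : x = a'
        · subst h2
          simp only [τ, Equiv.trans_apply, Equiv.swap_apply_right, if_true, if_neg h1, eq_comm (a := c)]
          split_ifs <;> omega
        · simp only [τ, Equiv.trans_apply, Equiv.swap_apply_of_ne_of_ne h1 h2, if_neg h1, if_neg h2]
          simp
    simp only [A]
    rw [Finset.sum_congr rfl (fun x _ => this x), Finset.sum_add_distrib, Finset.sum_add_distrib]
    simp only [Finset.sum_ite_eq', Finset.mem_univ, if_true]
    ring
  have hsq : ∀ c, (A τ c) ^ 2 = (A σ c) ^ 2 + ((if c = att a then d * (2 * A σ (att a) + d) else 0) +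
      (if c = att a' then -d * (2 * A σ (att a') - d) else 0)) := by
    intro c
    rw [hA]
    by_cases h1 : c = att a
    · subst h1
      simp only [if_true, if_neg hne]; ring
    · by_cases h2 : c = att a'
      · subst h2
        simp only [if_true, if_neg h1]; ring
      · simp only [if_neg h1, if_neg h2]; ring
  rw [Finset.sum_congr rfl (fun c _ => hsq c), Finset.sum_add_distrib, Finset.sum_add_distrib] at hle
  simp only [Finset.sum_ite_eq', Finset.mem_univ, if_true] at hle
  have : 0 < d ^ 2 := by positivity
  rw [heq] at hle
  nlinarith


def wPar (P : ℕ) {Λ : Type} (len : Λ → ℕ) (att : Λ → Fin (P + 1)) :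
    Fin (P + 1) ⊕ (Σ l : Λ, Fin (len l)) → Fin (P + 1) ⊕ (Σ l : Λ, Fin (len l))
  | Sum.inl c => Sum.inl ⟨c.1 - 1, by omega⟩
  | Sum.inr x => if x.2.1 = 0 then Sum.inl (att x.1) else
      Sum.inr ⟨x.1, ⟨x.2.1 - 1, by have := x.2.2; omega⟩⟩

lemma lemC2 (P : ℕ) {Λ : Type} [Fintype Λ] [DecidableEq Λ] (len : Λ → ℕ) (att : Λ → Fin (P + 1))
    (hlen : ∀ l, 1 ≤ len l)
    (H1 : ∀ l l', att l ≠ att l' → ∃ a a', att a = att l ∧ att a' = att l' ∧ len a = len a')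
    (H2 : ∃ l, (att l : ℕ) = P) (H3 : ∃ l l', l ≠ l' ∧ att l = 0 ∧ att l' = 0) :
    ∃ g : Fin (P + 1) ⊕ (Σ l : Λ, Fin (len l)) → ℤ,
      (∀ x y, x ≠ Sum.inl 0 → y ≠ Sum.inl 0 → |g x| = |g y| → x = y) ∧
      (∀ x, x ≠ Sum.inl 0 → 1 ≤ |g x| ∧
        |g x| ≤ (Fintype.card (Fin (P + 1) ⊕ (Σ l : Λ, Fin (len l))) : ℤ) - 1) ∧
      g (Sum.inl 0) = 0 ∧
      Function.Injective (fun v =>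
        (∑ u, if u ≠ Sum.inl 0 ∧ wPar P len att u = v then g u else 0) - g v) := by
  classical
  obtain ⟨slen, σ₀, hσ₀, hsort⟩ := sort_slots len
  have hs1 : ∀ j, 1 ≤ slen j := by
    intro j
    rw [← σ₀.apply_symm_apply j, hσ₀]; exact hlen _
  let N : ℕ → Prop := fun c => ∃ l, (att l : ℕ) = c
  obtain ⟨F, hFr, hFi, hFN, hFp, hFl, hFy⟩ := lemC1 P _ slen hs1 hsort N
  let M : ℕ := P + ∑ l, (slen l - 1)
  change ∀ v, cMem P slen v → 1 ≤ F v ∧ F v ≤ (M : ℤ) at hFr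
  let base : Fin (P + 1) → ℤ := fun c =>
    (if c = 0 then 0 else F (Sum.inl c)) - (if c.1 + 1 ≤ P then F (Sum.inl (c.1 + 1)) else 0)
  obtain ⟨σ, hσ, hσA⟩ := max_assign len slen σ₀ hσ₀ att base (M + 1) H1
  let A : Fin (P + 1) → ℤ := fun c =>
    base c + ∑ x, if att x = c then ((σ x : ℕ) : ℤ) + (M + 1) else 0
  let code : Fin (P + 1) ⊕ (Σ l : Λ, Fin (len l)) → ℕ ⊕ (Σ _ : Fin (Fintype.card Λ), ℕ) :=
    fun v => match v with
    | Sum.inl c => Sum.inl c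
    | Sum.inr x => Sum.inr ⟨σ x.1, x.2⟩
  have hcode : Function.Injective code := by
    rintro (c | ⟨l, i⟩) (c' | ⟨l', i'⟩) h <;>
      simp only [code, Sum.inl.injEq, Sum.inr.injEq, reduceCtorEq, Sigma.mk.injEq, heq_eq_eq] at h
    · rw [Fin.ext h]
    · obtain ⟨h, h'⟩ := h
      have := σ.injective h
      subst this
      rw [Fin.ext h']
  let g : Fin (P + 1) ⊕ (Σ l : Λ, Fin (len l)) → ℤ := fun v => match v with
    | Sum.inl c => if c = 0 then 0 else - F (Sum.inl c)
    | Sum.inr x => if x.2.1 = 0 then ((σ x.1 : ℕ) : ℤ) + (M + 1) else - F (Sum.inr ⟨σ x.1, x.2⟩)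
  -- classification of labels
  have hg : ∀ v, v ≠ Sum.inl 0 → (cMem P slen (code v) ∧ |g v| = F (code v)) ∨
      (∃ l, v = Sum.inr ⟨l, ⟨0, hlen l⟩⟩ ∧ |g v| = ((σ l : ℕ) : ℤ) + (M + 1)) := by
    rintro (c | ⟨l, i, hi⟩) hv
    · have hc : c ≠ 0 := fun h => hv (by rw [h])
      have hm : cMem P slen (code (Sum.inl c)) := by
        have : c.1 ≠ 0 := fun h => hc (Fin.ext h)
        exact ⟨by omega, by omega⟩
      left
      refine ⟨hm, ?_⟩
      have := (hFr _ hm).1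
      simp only [code] at this
      simp only [g, code, if_neg hc, abs_neg]
      exact abs_of_nonneg (by omega)
    · by_cases h0 : i = 0
      · right
        subst h0
        refine ⟨l, rfl, ?_⟩
        simp only [g, if_true]
        exact abs_of_nonneg (by positivity)
      · left
        have hm : cMem P slen (code (Sum.inr ⟨l, i, hi⟩)) :=
          ⟨by show 1 ≤ i; omega, by show i < slen (σ l); rw [hσ]; exact hi⟩
        refine ⟨hm, ?_⟩
        have := (hFr _ hm).1
        simp only [code] at this
        simp only [g, code, if_neg h0, abs_neg]
        exact abs_of_nonneg (by omega)
  have hcard : (Fintype.card (Fin (P + 1) ⊕ (Σ l : Λ, Fin (len l))) : ℤ) - 1 =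
      M + Fintype.card Λ := by
    have e1 : ∑ l, len l = ∑ j, slen j := by
      rw [← σ.sum_comp]; exact Finset.sum_congr rfl fun l _ => (hσ l).symm
    have e2 : ∑ j, slen j = ∑ j, (slen j - 1) + Fintype.card Λ := by
      have : ∀ j, slen j = (slen j - 1) + 1 := fun j => by have := hs1 j; omega
      rw [Finset.sum_congr rfl fun j _ => this j, Finset.sum_add_distrib]
      simp
    simp only [Fintype.card_sum, Fintype.card_sigma, Fintype.card_fin, M]
    omega
  -- vertex sums
  have hSl : ∀ c, (∑ u, if u ≠ Sum.inl 0 ∧ wPar P len att u = Sum.inl c then g u else 0) -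
      g (Sum.inl c) = A c := by
    intro c
    rw [Fintype.sum_sum_type, Fintype.sum_sigma]
    have e1 : (∑ x : Fin (P + 1), if (Sum.inl x : Fin (P + 1) ⊕ (Σ l : Λ, Fin (len l))) ≠ Sum.inl 0 ∧
        wPar P len att (Sum.inl x) = Sum.inl c then g (Sum.inl x) else 0) =
        - (if c.1 + 1 ≤ P then F (Sum.inl (c.1 + 1)) else 0) := by
      by_cases h : c.1 + 1 ≤ P
      · rw [if_pos h, Finset.sum_eq_single ⟨c.1 + 1, by omega⟩]
        · rw [if_pos]
          · simp only [g]
            rw [if_neg]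
            intro h'; simpa using congrArg Fin.val h'
          · refine ⟨?_, ?_⟩
            · intro h'; simpa using congrArg Fin.val (Sum.inl.inj h')
            · simp [wPar]
        · intro b _ hb
          rw [if_neg]
          rintro ⟨h1, h2⟩
          apply hb
          simp only [wPar, Sum.inl.injEq, ne_eq] at h1 h2
          have h3 : b.1 ≠ 0 := fun h => h1 (Fin.ext h)
          have h4 := congrArg Fin.val h2
          apply Fin.ext
          simp only at h4 ⊢
          omega
        · simp
      · rw [if_neg h, neg_zero]
        apply Finset.sum_eq_zero
        intro b _
        rw [if_neg]
        rintro ⟨h1, h2⟩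
        simp only [wPar, Sum.inl.injEq, ne_eq] at h1 h2
        have h3 : b.1 ≠ 0 := fun h => h1 (Fin.ext h)
        have h4 := congrArg Fin.val h2
        simp only at h4
        omega
    have e2 : ∀ l : Λ, (∑ i : Fin (len l), if (Sum.inr ⟨l, i⟩ : Fin (P + 1) ⊕ (Σ l : Λ, Fin (len l))) ≠ Sum.inl 0 ∧
        wPar P len att (Sum.inr ⟨l, i⟩) = Sum.inl c then g (Sum.inr ⟨l, i⟩) else 0) =
        if att l = c then ((σ l : ℕ) : ℤ) + (M + 1) else 0 := by
      intro l
      rw [Finset.sum_eq_single ⟨0, hlen l⟩]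
      · simp [wPar, g]
      · intro b _ hb
        have : b.1 ≠ 0 := fun h => hb (Fin.ext h)
        simp [wPar, this]
      · simp
    rw [e1, Finset.sum_congr rfl fun l _ => e2 l]
    simp only [A, base, g]
    split_ifs <;> ring
  have hSr : ∀ l (i : Fin (len l)), (∑ u, if u ≠ Sum.inl 0 ∧ wPar P len att u = Sum.inr ⟨l, i⟩ then g u else 0) -
      g (Sum.inr ⟨l, i⟩) = (if i.1 = 0 then - (((σ l : ℕ) : ℤ) + (M + 1)) else F (Sum.inr ⟨σ l, i⟩)) -
        (if i.1 + 1 < len l then F (Sum.inr ⟨σ l, i.1 + 1⟩) else 0) := by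
    intro l i
    have e1 : (∑ u, if u ≠ Sum.inl 0 ∧ wPar P len att u = Sum.inr ⟨l, i⟩ then g u else 0) =
        - (if i.1 + 1 < len l then F (Sum.inr ⟨σ l, i.1 + 1⟩) else 0) := by
      have hch : ∀ u, wPar P len att u = Sum.inr ⟨l, i⟩ → ∃ h : i.1 + 1 < len l, u = Sum.inr ⟨l, ⟨i.1 + 1, h⟩⟩ := by
        rintro (c | ⟨l', i', hi'⟩) h
        · simp [wPar] at h
        · simp only [wPar] at h
          split_ifs at h with h0
          simp only [Sum.inr.injEq, Sigma.mk.injEq] at h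
          obtain ⟨rfl, h⟩ := h
          have h := congrArg Fin.val (eq_of_heq h)
          simp only at h
          have : i' = i.1 + 1 := by omega
          subst this
          exact ⟨hi', rfl⟩
      by_cases h : i.1 + 1 < len l
      · rw [if_pos h, Finset.sum_eq_single (Sum.inr ⟨l, ⟨i.1 + 1, h⟩⟩)]
        · simp [wPar, g]
        · intro b _ hb
          rw [if_neg]
          rintro ⟨_, h2⟩
          obtain ⟨_, h3⟩ := hch b h2
          exact hb h3
        · simp
      · rw [if_neg h, neg_zero]
        apply Finset.sum_eq_zero
        intro b _
        rw [if_neg]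
        rintro ⟨_, h2⟩
        obtain ⟨h3, _⟩ := hch b h2
        exact h h3
    rw [e1]
    simp only [g]
    split_ifs <;> ring
  have hT : ∀ c l, att l = c →
      (M : ℤ) + 1 ≤ ∑ x, if att x = c then ((σ x : ℕ) : ℤ) + (M + 1) else 0 := by
    intro c l hl
    have := Finset.single_le_sum (f := fun x => if att x = c then ((σ x : ℕ) : ℤ) + (M + 1) else 0)
      (s := Finset.univ) (fun x _ => by split_ifs <;> positivity) (Finset.mem_univ l)
    simp only [if_pos hl] at this
    omega
  have hT0 : 2 * ((M : ℤ) + 1) ≤ ∑ x, if att x = 0 then ((σ x : ℕ) : ℤ) + (M + 1) else 0 := by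
    obtain ⟨l, l', hne, hl, hl'⟩ := H3
    have := Finset.add_le_sum (f := fun x => if att x = 0 then ((σ x : ℕ) : ℤ) + (M + 1) else 0)
      (s := Finset.univ) (fun x _ => by split_ifs <;> positivity) (Finset.mem_univ l)
      (Finset.mem_univ l') hne
    simp only [if_pos hl, if_pos hl'] at this
    omega
  have hAN : ∀ c l, att l = c → (M : ℤ) + 1 ≤ A c := by
    intro c l hl
    by_cases h0 : c = 0
    · subst h0
      simp only [A, base, if_true]
      split_ifs with h
      · have := (hFr (Sum.inl ((0 : Fin (P + 1)).1 + 1)) ⟨by omega, h⟩).2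
        omega
      · omega
    · have h1 := hT c l hl
      have h0' : c.1 ≠ 0 := fun h => h0 (Fin.ext h)
      simp only [A, base, if_neg h0]
      split_ifs with h
      · have := hFN c.1 (by omega) h ⟨l, by rw [hl]⟩
        omega
      · have := (hFr (Sum.inl c.1) ⟨by omega, by omega⟩).1
        omega
  let y : Fin (Fintype.card Λ) → ℤ := fun j => if 1 < slen j then F (Sum.inr ⟨j, 1⟩) else 0
  have hy0 : ∀ j, 0 ≤ y j := by
    intro j
    simp only [y]
    split_ifs with h
    · have := (hFr (Sum.inr ⟨j, 1⟩) ⟨le_refl _, h⟩).1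
      omega
    · exact le_refl _
  let S : Fin (P + 1) ⊕ (Σ l : Λ, Fin (len l)) → ℤ := fun v =>
        (∑ u, if u ≠ Sum.inl 0 ∧ wPar P len att u = v then g u else 0) - g v
  have hcl : ∀ v, (∃ l, v = Sum.inl (att l) ∧ S v = A (att l)) ∨
      (cMem P slen (code v) ∧ cMem P slen (cNxt (code v)) ∧ cZ N (code v) ∧
        S v = F (code v) - F (cNxt (code v))) ∨
      (∃ l, v = Sum.inr ⟨l, ⟨0, hlen l⟩⟩ ∧ S v = - (((σ l : ℕ) : ℤ) + (M + 1)) - y (σ l)) ∨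
      (∃ j i, 1 ≤ i ∧ i + 1 = slen j ∧ code v = Sum.inr ⟨j, i⟩ ∧ S v = F (code v)) := by
    rintro (c | ⟨l, i, hi⟩)
    · by_cases hN : ∃ l, att l = c
      · obtain ⟨l, rfl⟩ := hN
        left
        exact ⟨l, rfl, hSl _⟩
      · right; left
        have h0 : c ≠ 0 := by
          obtain ⟨l, _, _, hl, _⟩ := H3
          intro h; exact hN ⟨l, by rw [hl, h]⟩
        have hP : c.1 ≠ P := by
          obtain ⟨l, hl⟩ := H2
          intro h; exact hN ⟨l, Fin.ext (by omega)⟩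
        have h0' : c.1 ≠ 0 := fun h => h0 (Fin.ext h)
        refine ⟨⟨by omega, by omega⟩, ⟨by omega, by omega⟩, ?_, ?_⟩
        · rintro ⟨l, hl⟩
          exact hN ⟨l, Fin.ext hl⟩
        · rw [show S (Sum.inl c) = A c from hSl c]
          have hz : ∑ x, (if att x = c then ((σ x : ℕ) : ℤ) + (M + 1) else 0) = 0 := by
            apply Finset.sum_eq_zero
            intro x _
            rw [if_neg]
            intro h; exact hN ⟨x, h⟩
          simp only [A, base, hz, if_neg h0]
          rw [if_pos (by omega)]
          simp [code, cNxt]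
    · have hS : S (Sum.inr ⟨l, i, hi⟩) = _ := hSr l ⟨i, hi⟩
      by_cases h0 : i = 0
      · right; right; left
        subst h0
        refine ⟨l, rfl, ?_⟩
        rw [hS]
        simp [y, hσ]
      · by_cases h1 : i + 1 < len l
        · right; left
          refine ⟨⟨by show 1 ≤ i; omega, by show i < slen (σ l); rw [hσ]; omega⟩,
            ⟨by show 1 ≤ i + 1; omega, by show i + 1 < slen (σ l); rw [hσ]; omega⟩, trivial, ?_⟩
          rw [hS]
          simp [code, cNxt, h0, h1]
        · right; right; right
          refine ⟨σ l, i, by omega, by rw [hσ]; omega, rfl, ?_⟩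
          rw [hS]
          simp [code, h0, h1]
  refine ⟨g, ?_, ?_, ?_, ?_⟩
  · intro x y' hx hy' he
    rcases hg x hx with ⟨m1, e1⟩ | ⟨l, rfl, e1⟩ <;> rcases hg y' hy' with ⟨m2, e2⟩ | ⟨l', rfl, e2⟩
    · exact hcode (hFi _ _ m1 m2 (by rw [← e1, ← e2, he]))
    · have := hFr _ m1; omega
    · have := hFr _ m2; omega
    · have : σ l = σ l' := Fin.ext (by omega)
      rw [σ.injective this]
  · intro x hx
    rw [hcard]
    rcases hg x hx with ⟨m1, e1⟩ | ⟨l, rfl, e1⟩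
    · have := hFr _ m1; omega
    · have := (σ l).2; omega
  · simp [g]
  · have main : ∀ v w, S v = S w → v = w := by
      have hb : ∀ v, cMem P slen (code v) → cMem P slen (cNxt (code v)) →
          S v = F (code v) - F (cNxt (code v)) → |S v| ≤ M := by
        intro v h h' h''
        have := hFr _ h
        have := hFr _ h'
        rw [h'', abs_le]; omega
      intro v w he
      rcases hcl v with ⟨l, rfl, e1⟩ | ⟨m1, n1, z1, e1⟩ | ⟨l, rfl, e1⟩ | ⟨j, i, hi, hi', c1, e1⟩ <;>
      rcases hcl w with ⟨l', rfl, e2⟩ | ⟨m2, n2, z2, e2⟩ | ⟨l', rfl, e2⟩ | ⟨j', i', hj, hj', c2, e2⟩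
      · by_contra hne
        exact hσA l l' (fun h => hne (by rw [h])) (by rw [e1, e2] at he; exact he)
      · have := hAN _ l rfl
        have := abs_le.1 (hb w m2 n2 e2)
        omega
      · have := hAN _ l rfl
        have := hy0 (σ l')
        omega
      · have := hAN _ l rfl
        have := hFr (code w) (by rw [c2]; exact ⟨hj, by show i' < slen j'; omega⟩)
        omega
      · have := hAN _ l' rfl
        have := abs_le.1 (hb v m1 n1 e1)
        omega
      · exact hcode (hFp _ _ m1 n1 z1 m2 n2 z2 (by rw [← e1, ← e2, he]))
      · have := abs_le.1 (hb v m1 n1 e1)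
        have := hy0 (σ l')
        omega
      · exact absurd (by rw [← e1, he, e2, c2]) (hFl _ m1 n1 z1 j' i' hj hj')
      · have := hAN _ l' rfl
        have := hy0 (σ l)
        omega
      · have := abs_le.1 (hb w m2 n2 e2)
        have := hy0 (σ l)
        omega
      · rcases lt_trichotomy (σ l) (σ l') with h | h | h
        · have h1 : y (σ l) ≤ y (σ l') := hFy _ _ h
          have h2 : (σ l).1 < (σ l').1 := h
          omega
        · rw [σ.injective h]
        · have h1 : y (σ l') ≤ y (σ l) := hFy _ _ h
          have h2 : (σ l').1 < (σ l).1 := h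
          omega
      · have := hFr (code w) (by rw [c2]; exact ⟨hj, by show i' < slen j'; omega⟩)
        have := hy0 (σ l)
        omega
      · have := hAN _ l' rfl
        have := hFr (code v) (by rw [c1]; exact ⟨hi, by show i < slen j; omega⟩)
        omega
      · exact absurd (by rw [← e2, ← he, e1, c1]) (hFl _ m2 n2 z2 j i hi hi')
      · have := hFr (code v) (by rw [c1]; exact ⟨hi, by show i < slen j; omega⟩)
        have := hy0 (σ l')
        omega
      · exact hcode (hFi _ _ (by rw [c1]; exact ⟨hi, by show i < slen j; omega⟩)
          (by rw [c2]; exact ⟨hj, by show i' < slen j'; omega⟩) (by rw [← e1, ← e2, he]))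
    exact fun v w h => main v w h


lemma wPar_ll (P : ℕ) {Λ : Type} (len : Λ → ℕ) (att : Λ → Fin (P + 1)) (c c' : Fin (P + 1)) :
    wPar P len att (Sum.inl c) = Sum.inl c' ↔ c.1 - 1 = c'.1 := by
  simp [wPar, Fin.ext_iff]

lemma wPar_lr (P : ℕ) {Λ : Type} (len : Λ → ℕ) (att : Λ → Fin (P + 1)) (c : Fin (P + 1))
    (y : Σ l : Λ, Fin (len l)) :
    wPar P len att (Sum.inl c) = Sum.inr y ↔ False := by
  simp [wPar]

lemma wPar_rl (P : ℕ) {Λ : Type} (len : Λ → ℕ) (att : Λ → Fin (P + 1)) (c : Fin (P + 1))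
    (l : Λ) (i : Fin (len l)) :
    wPar P len att (Sum.inr ⟨l, i⟩) = Sum.inl c ↔ i.1 = 0 ∧ (att l).1 = c.1 := by
  by_cases h : i.1 = 0 <;> simp [wPar, h, Fin.ext_iff]

lemma wPar_rr (P : ℕ) {Λ : Type} (len : Λ → ℕ) (att : Λ → Fin (P + 1))
    (l l' : Λ) (i : Fin (len l)) (i' : Fin (len l')) :
    wPar P len att (Sum.inr ⟨l, i⟩) = Sum.inr ⟨l', i'⟩ ↔ l = l' ∧ i.1 = i'.1 + 1 := by
  by_cases h : i.1 = 0
  · simp [wPar, h]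
  · simp only [wPar, h, if_false, Sum.inr.injEq, Sigma.mk.injEq]
    constructor
    · rintro ⟨rfl, h'⟩
      have := congrArg Fin.val (eq_of_heq h')
      simp only at this
      exact ⟨rfl, by omega⟩
    · rintro ⟨rfl, h'⟩
      refine ⟨rfl, heq_of_eq (Fin.ext ?_)⟩
      simp only
      omega

lemma wPar_two (P : ℕ) {Λ : Type} (len : Λ → ℕ) (att : Λ → Fin (P + 1))
    (x : Fin (P + 1) ⊕ (Σ l : Λ, Fin (len l))) (hx : x ≠ Sum.inl 0) :
    wPar P len att (wPar P len att x) ≠ x := by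
  rcases x with c | ⟨l, i⟩
  · have : c.1 ≠ 0 := fun h => hx (by rw [show c = 0 from Fin.ext h])
    rw [show wPar P len att (Sum.inl c) = Sum.inl ⟨c.1 - 1, by omega⟩ from rfl, ne_eq, wPar_ll]
    simp only
    omega
  · generalize hy : wPar P len att (Sum.inr ⟨l, i⟩) = y
    rcases y with c | ⟨l', i'⟩
    · rw [ne_eq, wPar_lr]; exact id
    · rw [wPar_rr] at hy
      rw [ne_eq, wPar_rr]
      omega

def tLen (q b s k : ℕ) : Fin s ⊕ Bool → ℕ
  | Sum.inl _ => k
  | Sum.inr false => q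
  | Sum.inr true => b

def tAtt (P q s : ℕ) (a : Fin s → ℕ) (ha : ∀ i, a i - q < P + 1) : Fin s ⊕ Bool → Fin (P + 1)
  | Sum.inl i => ⟨a i - q, ha i⟩
  | Sum.inr false => 0
  | Sum.inr true => Fin.last P

def tMap (p q q' s k : ℕ) (h1 : q ≤ q') (h2 : q' < p) :
    Fin (q' - q + 1) ⊕ (Σ l : Fin s ⊕ Bool, Fin (tLen q (p - q') s k l)) →
      Fin (p + 1) ⊕ Fin s × Fin k
  | Sum.inl c => Sum.inl ⟨q + c.1, by omega⟩
  | Sum.inr ⟨Sum.inl l, i⟩ => Sum.inr (l, (⟨i.1, i.2⟩ : Fin k))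
  | Sum.inr ⟨Sum.inr false, i⟩ => Sum.inl ⟨q - 1 - i.1, by omega⟩
  | Sum.inr ⟨Sum.inr true, i⟩ => Sum.inl ⟨q' + 1 + i.1, by
      have : i.1 < p - q' := i.2
      omega⟩

lemma tMap_bij (p q q' s k : ℕ) (h1 : q ≤ q') (h2 : q' < p) :
    Function.Bijective (tMap p q q' s k h1 h2) := by
  constructor
  · rintro (⟨c, hc⟩ | ⟨l | (_ | _), ⟨i, hi⟩⟩) (⟨c', hc'⟩ | ⟨l' | (_ | _), ⟨i', hi'⟩⟩) h <;>
      (try simp only [tLen] at hi) <;> (try simp only [tLen] at hi') <;>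
      simp only [tMap, Sum.inl.injEq, Sum.inr.injEq, Fin.mk.injEq, reduceCtorEq, Prod.mk.injEq] at h
    · have : c = c' := by omega
      subst this; rfl
    · omega
    · omega
    · obtain ⟨rfl, h⟩ := h
      have := congrArg Fin.val h
      simp only at this
      subst this; rfl
    · omega
    · have : i = i' := by omega
      subst this; rfl
    · omega
    · omega
    · omega
    · have : i = i' := by omega
      subst this; rfl
  · rintro (⟨j, hj⟩ | ⟨l, i⟩)
    · by_cases a : j < q
      · refine ⟨Sum.inr ⟨Sum.inr false, ⟨q - 1 - j, by show _ < q; omega⟩⟩, ?_⟩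
        simp only [tMap, Sum.inl.injEq, Fin.mk.injEq]; omega
      · by_cases b : j ≤ q'
        · refine ⟨Sum.inl ⟨j - q, by omega⟩, ?_⟩
          simp only [tMap, Sum.inl.injEq, Fin.mk.injEq]; omega
        · refine ⟨Sum.inr ⟨Sum.inr true, ⟨j - q' - 1, by show _ < p - q'; omega⟩⟩, ?_⟩
          simp only [tMap, Sum.inl.injEq, Fin.mk.injEq]; omega
    · exact ⟨Sum.inr ⟨Sum.inl l, i⟩, rfl⟩

lemma tMap_adj (p q q' s k : ℕ) (h1 : q ≤ q') (h2 : q' < p) (attach : Fin s → Fin (p + 1))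
    (hq : ∀ i, q ≤ (attach i : ℕ) ∧ (attach i : ℕ) ≤ q')
    (ha : ∀ i, (attach i : ℕ) - q < q' - q + 1) (hq1 : 1 ≤ q) (hk : 1 ≤ k)
    (x y : Fin (q' - q + 1) ⊕ (Σ l : Fin s ⊕ Bool, Fin (tLen q (p - q') s k l))) :
    (subdividedCaterpillar p s k attach).Adj (tMap p q q' s k h1 h2 x) (tMap p q q' s k h1 h2 y) ↔
      (x ≠ Sum.inl 0 ∧ wPar (q' - q) (tLen q (p - q') s k)
        (tAtt (q' - q) q s (fun i => (attach i : ℕ)) ha) x = y) ∨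
      (y ≠ Sum.inl 0 ∧ wPar (q' - q) (tLen q (p - q') s k)
        (tAtt (q' - q) q s (fun i => (attach i : ℕ)) ha) y = x) := by
  rcases x with (⟨c, hc⟩ | ⟨l | (_ | _), ⟨i, hi⟩⟩) <;>
  rcases y with (⟨c', hc'⟩ | ⟨l' | (_ | _), ⟨i', hi'⟩⟩) <;>
      (try simp only [tLen] at hi) <;> (try simp only [tLen] at hi') <;>
      simp only [subdividedCaterpillar, SimpleGraph.fromRel_adj, tMap, wPar_ll, wPar_lr, wPar_rl,
        wPar_rr, tAtt, ne_eq, Sum.inl.injEq, Sum.inr.injEq, Prod.mk.injEq, Fin.ext_iff,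
        reduceCtorEq, not_false_eq_true, true_and, and_true, and_false, false_or, or_false,
        false_and, Fin.val_zero, Fin.val_last, Bool.false_eq_true, iff_false] <;>
      (try have := hq l) <;> (try have := hq l') <;> omega

lemma main_lemma {V : Type*} [DecidableEq V] (G : SimpleGraph V) [Fintype G.edgeSet]
    (p s k : ℕ) (hp : 2 ≤ p) (hk : 1 ≤ k)
    (attach : Fin s → Fin (p + 1))
    (hattach : ∀ i, 0 < (attach i : ℕ) ∧ (attach i : ℕ) < p)
    (hiso : Nonempty (G ≃g subdividedCaterpillar p s k attach)) :
    HasAntimagicOrientation G := by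
  obtain ⟨iso⟩ := hiso
  obtain ⟨q, q', hq1, hqq, hqp, hq, hr⟩ : ∃ q q' : ℕ, 1 ≤ q ∧ q ≤ q' ∧ q' < p ∧
      (∀ i, q ≤ (attach i : ℕ) ∧ (attach i : ℕ) ≤ q') ∧
      ((s = 0 ∧ q = q') ∨ ((∃ i, (attach i : ℕ) = q) ∧ (∃ i, (attach i : ℕ) = q'))) := by
    rcases Nat.eq_zero_or_pos s with h | h
    · subst h
      exact ⟨1, 1, le_refl _, le_refl _, by omega, fun i => i.elim0, Or.inl ⟨rfl, rfl⟩⟩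
    · have : Nonempty (Fin s) := ⟨⟨0, h⟩⟩
      obtain ⟨i, hi⟩ := Finite.exists_min (fun i => (attach i : ℕ))
      obtain ⟨j, hj⟩ := Finite.exists_max (fun i => (attach i : ℕ))
      exact ⟨attach i, attach j, (hattach i).1, hi j, (hattach j).2, fun l => ⟨hi l, hj l⟩,
        Or.inr ⟨⟨i, rfl⟩, ⟨j, rfl⟩⟩⟩
  have ha : ∀ i, (attach i : ℕ) - q < q' - q + 1 := fun i => by
    have := hq i; omega
  obtain ⟨g, g1, g2, g3, g4⟩ := lemC2 (q' - q) (tLen q (p - q') s k)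
    (tAtt (q' - q) q s (fun i => (attach i : ℕ)) ha)
    (by rintro (l | (_ | _)) <;> simp only [tLen] <;> omega)
    (by
      rcases hr with ⟨hs, he⟩ | ⟨⟨i, hi⟩, ⟨j, hj⟩⟩
      · intro l l' h
        exact absurd (Fin.ext (by omega)) h
      · have : ∀ l, ∃ a : Fin s, tAtt (q' - q) q s (fun i => (attach i : ℕ)) ha (Sum.inl a) =
            tAtt (q' - q) q s (fun i => (attach i : ℕ)) ha l := by
          rintro (l | (_ | _))
          · exact ⟨l, rfl⟩
          · exact ⟨i, Fin.ext (by simp [tAtt, hi])⟩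
          · exact ⟨j, Fin.ext (by simp [tAtt, hj])⟩
        intro l l' _
        obtain ⟨a, e⟩ := this l
        obtain ⟨a', e'⟩ := this l'
        exact ⟨_, _, e, e', rfl⟩)
    ⟨Sum.inr true, by simp [tAtt]⟩
    (by
      rcases hr with ⟨hs, he⟩ | ⟨⟨i, hi⟩, _⟩
      · refine ⟨Sum.inr false, Sum.inr true, by simp, rfl, Fin.ext ?_⟩
        simp [tAtt]; omega
      · exact ⟨Sum.inr false, Sum.inl i, by simp, rfl, Fin.ext (by simp [tAtt, hi])⟩)
  refine tree_lemma G ((Equiv.ofBijective _ (tMap_bij p q q' s k hqq hqp)).trans iso.symm.toEquiv)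
    (Sum.inl 0) _ ?_ (fun x hx _ => wPar_two _ _ _ x hx) g g1 g2 g3 g4
  intro x y
  rw [← tMap_adj p q q' s k hqq hqp attach hq ha hq1 hk x y]
  exact iso.symm.map_adj_iff

/-- **Every subdivided caterpillar admits an antimagic orientation.**
A subdivided caterpillar is (up to isomorphism) a graph obtained from a caterpillar,
i.e. a spine path `v_0 ⋯ v_p` (`p ≥ 2`) with pendant edges (legs) attached to internal
spine vertices, by subdividing every leg the same number of times, so that all legs
become paths of the same length `k ≥ 1`. -/
theorem subdividedCaterpillar_hasAntimagicOrientation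
    {V : Type*} [DecidableEq V] (G : SimpleGraph V) [Fintype G.edgeSet]
    (p s k : ℕ) (hp : 2 ≤ p) (hk : 1 ≤ k)
    (attach : Fin s → Fin (p + 1))
    (hattach : ∀ i, 0 < (attach i : ℕ) ∧ (attach i : ℕ) < p)
    (hiso : Nonempty (G ≃g subdividedCaterpillar p s k attach)) :
    HasAntimagicOrientation G := by
  exact main_lemma G p s k hp hk attach hattach hiso
end

section
/- Every subdivided caterpillar that has exactly one leg admits an antimagic orientation. -/
structure Spider {V : Type*} (G : SimpleGraph V) (L : Fin 3 → ℕ → V) (n : Fin 3 → ℕ) : Prop where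
  pos : ∀ i, 0 < n i
  zero : ∀ i, L i 0 = L 0 0
  inj : ∀ i j i' j', j ≤ n i → j' ≤ n i' → L i j = L i' j' → (j = 0 ∧ j' = 0) ∨ (i = i' ∧ j = j')
  surj : ∀ v, ∃ i j, j ≤ n i ∧ v = L i j
  adj : ∀ u v, G.Adj u v ↔ ∃ i j, j < n i ∧
    ((u = L i j ∧ v = L i (j+1)) ∨ (v = L i j ∧ u = L i (j+1)))

theorem Spider.perm {V : Type*} {G : SimpleGraph V} {L : Fin 3 → ℕ → V} {n : Fin 3 → ℕ}
    (h : Spider G L n) (σ : Equiv.Perm (Fin 3)) :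
    Spider G (fun i => L (σ i)) (fun i => n (σ i)) where
  pos i := h.pos _
  zero i := by rw [h.zero (σ i), h.zero (σ 0)]
  inj i j i' j' h1 h2 h3 := by
    rcases h.inj _ _ _ _ h1 h2 h3 with h | ⟨h, h'⟩
    · exact Or.inl h
    · exact Or.inr ⟨σ.injective h, h'⟩
  surj v := by
    obtain ⟨i, j, h1, h2⟩ := h.surj v
    exact ⟨σ.symm i, j, by simpa using h1, by simpa using h2⟩
  adj u v := by
    rw [h.adj]
    constructor
    · rintro ⟨i, j, h1⟩
      exact ⟨σ.symm i, j, by simpa using h1⟩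
    · rintro ⟨i, j, h1⟩
      exact ⟨σ i, j, h1⟩

theorem Spider.iso {V W : Type*} {G : SimpleGraph V} {H : SimpleGraph W} {L : Fin 3 → ℕ → W}
    {n : Fin 3 → ℕ} (h : Spider H L n) (φ : G ≃g H) :
    Spider G (fun i j => φ.symm (L i j)) n where
  pos := h.pos
  zero i := by rw [h.zero]
  inj i j i' j' h1 h2 h3 := h.inj _ _ _ _ h1 h2 (φ.symm.injective h3)
  surj v := by
    obtain ⟨i, j, h1, h2⟩ := h.surj (φ v)
    exact ⟨i, j, h1, by rw [← h2]; simp⟩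
  adj u v := by
    rw [← φ.map_adj_iff, h.adj]
    have key : ∀ (x : V) (y : W), φ x = y ↔ x = φ.symm y := fun x y => by
      constructor
      · rintro rfl; simp
      · rintro rfl; simp
    simp only [key]

theorem Spider.core {V : Type*} [DecidableEq V] {G : SimpleGraph V} [Fintype G.edgeSet]
    {L : Fin 3 → ℕ → V} {n : Fin 3 → ℕ} (h : Spider G L n) (w : Fin 3 → ℕ → ℤ)
    (hw0 : ∀ i j, n i ≤ j → w i j = 0)
    (hwr : ∀ i j, j < n i → 1 ≤ |w i j| ∧ |w i j| ≤ n 0 + n 1 + n 2)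
    (hwi : ∀ i j i' j', j < n i → j' < n i' → |w i j| = |w i' j'| → i = i' ∧ j = j')
    (hc : ∀ i j, j < n i → w 0 0 + w 1 0 + w 2 0 ≠ w i (j+1) - w i j)
    (hd : ∀ i j i' j', j < n i → j' < n i' → w i (j+1) - w i j = w i' (j'+1) - w i' j' →
      i = i' ∧ j = j') :
    HasAntimagicOrientation G := by
  classical
  have hadj : ∀ i j, j < n i → G.Adj (L i j) (L i (j+1)) := fun i j hj =>
    (h.adj _ _).2 ⟨i, j, hj, Or.inl ⟨rfl, rfl⟩⟩
  let F : (Σ i : Fin 3, Fin (n i)) → G.edgeSet := fun x =>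
    ⟨s(L x.1 x.2, L x.1 (x.2 + 1)), hadj _ _ x.2.2⟩
  have hF : Function.Bijective F := by
    constructor
    · rintro ⟨i, j, hj⟩ ⟨i', j', hj'⟩ he
      have he' := congrArg Subtype.val he
      simp only [F, Sym2.eq_iff] at he'
      have : i = i' ∧ j = j' := by
        rcases he' with ⟨h1, h2⟩ | ⟨h1, h2⟩
        · rcases h.inj _ _ _ _ (by omega) (by omega) h2 with h3 | h3
          · omega
          · exact ⟨h3.1, by omega⟩
        · rcases h.inj _ _ _ _ (by omega) (by omega) h1 with h3 | h3 <;>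
          rcases h.inj _ _ _ _ (by omega) (by omega) h2 with h4 | h4 <;> omega
      obtain ⟨rfl, rfl⟩ := this
      rfl
    · rintro ⟨e, he⟩
      induction e using Sym2.ind with
      | _ u v =>
        obtain ⟨i, j, hj, h1⟩ := (h.adj u v).1 he
        refine ⟨⟨i, j, hj⟩, Subtype.ext ?_⟩
        rcases h1 with ⟨rfl, rfl⟩ | ⟨rfl, rfl⟩
        · rfl
        · exact Sym2.eq_swap
  let E := Equiv.ofBijective F hF
  have hcard : (G.edgeFinset.card : ℤ) = n 0 + n 1 + n 2 := by
    have h1 : G.edgeFinset.card = Fintype.card G.edgeSet := by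
      simp [SimpleGraph.edgeFinset]
    rw [h1, ← Fintype.card_congr E, Fintype.card_sigma, Fin.sum_univ_three]
    simp
  let hd' : (Σ i : Fin 3, Fin (n i)) → V := fun x =>
    if 0 < w x.1 x.2 then L x.1 x.2 else L x.1 (x.2 + 1)
  let lb : (Σ i : Fin 3, Fin (n i)) → ℤ := fun x => |w x.1 x.2|
  have hsum : ∀ v, orientedVertexSum G (fun e => hd' (E.symm e)) (fun e => lb (E.symm e)) v =
      ∑ i : Fin 3, ∑ j ∈ Finset.range (n i), ((if L i j = v then w i j else 0) -
        (if L i (j+1) = v then w i j else 0)) := by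
    intro v
    unfold orientedVertexSum
    rw [← Equiv.sum_comp E, Fintype.sum_sigma]
    refine Finset.sum_congr rfl fun i _ => ?_
    rw [← Fin.sum_univ_eq_sum_range (fun j => (if L i j = v then w i j else 0) -
        (if L i (j+1) = v then w i j else 0)) (n i)]
    refine Finset.sum_congr rfl fun j _ => ?_
    have hne := (hadj i j j.2).ne
    have hE : ((E ⟨i, j⟩ : G.edgeSet) : Sym2 V) = s(L i j, L i (j+1)) := rfl
    simp only [Equiv.symm_apply_apply, hE, Sym2.mem_iff, hd', lb]
    have hw1 := (hwr i j j.2).1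
    by_cases hp : 0 < w i j
    · rw [abs_of_pos hp]
      simp only [hp, if_true]
      by_cases h1 : L i j = v
      · subst h1; simp [hne.symm]
      · by_cases h2 : L i (j+1) = v
        · subst h2; simp [hne]
        · simp [h1, h2, Ne.symm h1, Ne.symm h2]
    · rw [abs_of_nonpos (not_lt.1 hp)]
      simp only [hp, if_false]
      by_cases h1 : L i j = v
      · subst h1; simp [hne.symm]
      · by_cases h2 : L i (j+1) = v
        · subst h2; simp [hne]
        · simp [h1, h2, Ne.symm h1, Ne.symm h2]
  have hval0 : ∀ v, v = L 0 0 → orientedVertexSum G (fun e => hd' (E.symm e))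
      (fun e => lb (E.symm e)) v = w 0 0 + w 1 0 + w 2 0 := by
    rintro v rfl
    rw [hsum]
    have : ∀ i, ∑ j ∈ Finset.range (n i), ((if L i j = L 0 0 then w i j else 0) -
        (if L i (j+1) = L 0 0 then w i j else 0)) = w i 0 := by
      intro i
      rw [Finset.sum_eq_single 0]
      · rw [if_pos (h.zero i), if_neg, sub_zero]
        intro h1
        have := h.inj _ _ _ _ (h.pos i) (Nat.zero_le _) h1
        omega
      · intro j hj hj0
        rw [Finset.mem_range] at hj
        rw [if_neg, if_neg, sub_zero]
        · intro h1
          have := h.inj _ _ _ _ (by omega) (Nat.zero_le _) h1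
          omega
        · intro h1
          have := h.inj _ _ _ _ (by omega) (Nat.zero_le _) h1
          omega
      · intro h1
        exact absurd (Finset.mem_range.2 (h.pos i)) h1
    rw [Fin.sum_univ_three, this, this, this]
  have hval1 : ∀ i j, j < n i → orientedVertexSum G (fun e => hd' (E.symm e))
      (fun e => lb (E.symm e)) (L i (j+1)) = w i (j+1) - w i j := by
    intro i j hj
    rw [hsum, Finset.sum_eq_single i]
    · rw [Finset.sum_sub_distrib]
      congr 1
      · have : ∀ j' ∈ Finset.range (n i), (if L i j' = L i (j+1) then w i j' else 0) =
            if j' = j+1 then w i j' else 0 := by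
          intro j' hj'
          rw [Finset.mem_range] at hj'
          congr 1
          refine propext ⟨fun h1 => ?_, fun h1 => by rw [h1]⟩
          have := h.inj _ _ _ _ (by omega) (by omega) h1
          omega
        rw [Finset.sum_congr rfl this, Finset.sum_ite_eq']
        split_ifs with h1
        · rfl
        · exact (hw0 _ _ (by simpa using h1)).symm
      · have : ∀ j' ∈ Finset.range (n i), (if L i (j'+1) = L i (j+1) then w i j' else 0) =
            if j' = j then w i j' else 0 := by
          intro j' hj'
          rw [Finset.mem_range] at hj'
          congr 1
          refine propext ⟨fun h1 => ?_, fun h1 => by rw [h1]⟩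
          have := h.inj _ _ _ _ (by omega) (by omega) h1
          omega
        rw [Finset.sum_congr rfl this, Finset.sum_ite_eq', if_pos (Finset.mem_range.2 hj)]
    · intro i' _ hi'
      refine Finset.sum_eq_zero fun j' hj' => ?_
      rw [Finset.mem_range] at hj'
      rw [if_neg, if_neg, sub_zero]
      · intro h1
        rcases h.inj _ _ _ _ (by omega) (by omega) h1 with h2 | h2
        · omega
        · exact hi' h2.1
      · intro h1
        rcases h.inj _ _ _ _ (by omega) (by omega) h1 with h2 | h2
        · omega
        · exact hi' h2.1
    · simp
  have hinjl : Function.Injective lb := by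
    rintro ⟨i, j, hj⟩ ⟨i', j', hj'⟩ h1
    obtain ⟨rfl, rfl⟩ := hwi i j i' j' hj hj' h1
    rfl
  have hv : ∀ v, v = L 0 0 ∨ ∃ i j, j < n i ∧ v = L i (j+1) := by
    intro v
    obtain ⟨i, j, hj, rfl⟩ := h.surj v
    cases j with
    | zero => exact Or.inl (h.zero i)
    | succ j => exact Or.inr ⟨i, j, hj, rfl⟩
  refine ⟨fun e => hd' (E.symm e), fun e => lb (E.symm e), ?_, ?_, ?_⟩
  · intro e
    obtain ⟨⟨i, j⟩, rfl⟩ := E.surjective e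
    have hE : ((E ⟨i, j⟩ : G.edgeSet) : Sym2 V) = s(L i j, L i (j+1)) := rfl
    simp only [Equiv.symm_apply_apply, hE, Sym2.mem_iff, hd']
    split_ifs <;> simp
  · rw [hcard]
    have hmaps : ∀ x, lb x ∈ Finset.Icc (1:ℤ) (n 0 + n 1 + n 2) := fun x =>
      Finset.mem_Icc.2 (hwr _ _ x.2.2)
    refine ⟨fun e _ => by simpa using hmaps (E.symm e), fun a _ b _ hab =>
      E.symm.injective (hinjl hab), ?_⟩
    intro y hy
    have him : Finset.univ.image lb = Finset.Icc (1:ℤ) (n 0 + n 1 + n 2) := by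
      apply Finset.eq_of_subset_of_card_le
      · intro z hz
        obtain ⟨x, _, rfl⟩ := Finset.mem_image.1 hz
        exact hmaps x
      · rw [Finset.card_image_of_injective _ hinjl, Finset.card_univ, Fintype.card_sigma,
          Fin.sum_univ_three, Int.card_Icc]
        simp only [Fintype.card_fin]
        omega
    have hy' : y ∈ Finset.univ.image lb := by
      rw [him]; exact Finset.mem_Icc.2 hy
    obtain ⟨x, _, rfl⟩ := Finset.mem_image.1 hy'
    exact ⟨E x, Set.mem_univ _, by simp⟩
  · intro u v huv
    rcases hv u with hu | ⟨i, j, hj, rfl⟩ <;> rcases hv v with hv | ⟨i', j', hj', rfl⟩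
    · rw [hu, hv]
    · rw [hval0 u hu, hval1 _ _ hj'] at huv
      exact absurd huv (hc _ _ hj')
    · rw [hval0 v hv, hval1 _ _ hj] at huv
      exact absurd huv.symm (hc _ _ hj)
    · rw [hval1 _ _ hj, hval1 _ _ hj'] at huv
      obtain ⟨rfl, rfl⟩ := hd _ _ _ _ hj hj' huv
      rfl

def altf (l : ℕ) : ℤ := if l % 2 = 0 then (l : ℤ) else -(l : ℤ)

/-- weights of a leg with offset `o`, length `n`, direction `d` -/
def legw (d : Bool) (o n j : ℕ) : ℤ :=
  if n ≤ j then 0 else if d then altf (o + n - j) else - altf (o + j + 1)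

theorem altf_abs (l : ℕ) : |altf l| = l := by
  unfold altf; split_ifs <;> simp

/-- position (label) of an edge -/
def legp (d : Bool) (o n j : ℕ) : ℕ := if d then o + n - j else o + j + 1

theorem legw_abs (d : Bool) (o n j : ℕ) (h : j < n) : |legw d o n j| = legp d o n j := by
  unfold legw legp
  rw [if_neg (by omega)]
  cases d <;> simp [altf_abs]

theorem legw_int (d : Bool) (o n j : ℕ) (h : j + 1 < n) :
    ∃ l : ℕ, o < l ∧ l < o + n ∧ (d = true → l + j + 1 = o + n) ∧ (d = false → l = o + j + 1) ∧
      legw d o n (j+1) - legw d o n j = altf l - altf (l+1) := by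
  unfold legw
  rw [if_neg (by omega : ¬ n ≤ j + 1), if_neg (by omega : ¬ n ≤ j)]
  cases d
  · refine ⟨o + j + 1, by omega, by omega, by simp, by simp, ?_⟩
    simp [add_assoc]
    ring
  · refine ⟨o + n - (j+1), by omega, by omega, fun _ => by omega, by simp, ?_⟩
    have : o + n - (j+1) + 1 = o + n - j := by omega
    simp [this]

/-- leaf value -/
def legl (d : Bool) (o n : ℕ) : ℤ := if d then - altf (o + 1) else altf (o + n)

theorem legw_leaf (d : Bool) (o n j : ℕ) (h : j + 1 = n) :
    legw d o n (j+1) - legw d o n j = legl d o n := by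
  unfold legw legl
  subst h
  have : o + (j + 1) - j = o + 1 := by omega
  cases d <;> simp [this, add_assoc]

theorem altf_g (l : ℕ) : (altf l - altf (l+1)) % 4 = 1 ∧
    (0 < l → altf l - altf (l+1) ≠ 1) := by
  unfold altf; push_cast; constructor <;> (try intro) <;> split_ifs <;> omega

theorem altf_g_inj (l l' : ℕ) (h : altf l - altf (l+1) = altf l' - altf (l'+1)) : l = l' := by
  unfold altf at h; push_cast at h; split_ifs at h <;> omega

theorem Spider.num {V : Type*} [DecidableEq V] {G : SimpleGraph V} [Fintype G.edgeSet]
    {L : Fin 3 → ℕ → V} {n : Fin 3 → ℕ} (h : Spider G L n) (o : Fin 3 → ℕ) (d : Fin 3 → Bool)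
    (ho0 : o 0 = 0) (ho1 : o 1 = n 0) (ho2 : o 2 = n 0 + n 1)
    (c : ℤ) (hcd : c = legw (d 0) (o 0) (n 0) 0 + legw (d 1) (o 1) (n 1) 0 +
      legw (d 2) (o 2) (n 2) 0)
    (hc4 : c % 4 ≠ 1) (hcl : ∀ i, c ≠ legl (d i) (o i) (n i))
    (hl4 : ∀ i, legl (d i) (o i) (n i) % 4 ≠ 1 ∨ legl (d i) (o i) (n i) = 1)
    (hll : ∀ i i', legl (d i) (o i) (n i) = legl (d i') (o i') (n i') → i = i') :
    HasAntimagicOrientation G := by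
  have hblk : ∀ i i' l, o i < l → l ≤ o i + n i → o i' < l → l ≤ o i' + n i' → i = i' := by
    intro i i' l
    fin_cases i <;> fin_cases i' <;> simp [ho0, ho1, ho2] <;> omega
  have hrange : ∀ i, o i + n i ≤ n 0 + n 1 + n 2 := by
    intro i; fin_cases i <;> simp [ho0, ho1, ho2] <;> omega
  have hp : ∀ i j, j < n i → o i < legp (d i) (o i) (n i) j ∧
      legp (d i) (o i) (n i) j ≤ o i + n i := by
    intro i j hj
    unfold legp
    split_ifs <;> omega
  have hpi : ∀ i j j', j < n i → j' < n i →
      legp (d i) (o i) (n i) j = legp (d i) (o i) (n i) j' → j = j' := by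
    intro i j j' hj hj' h1
    unfold legp at h1
    split_ifs at h1 <;> omega
  have hnl : ∀ i l, 0 < l → altf l - altf (l+1) ≠ legl (d i) (o i) (n i) := by
    intro i l hl h1
    have := altf_g l
    rcases hl4 i with h2 | h2
    · rw [← h1] at h2; exact h2 this.1
    · exact this.2 hl (h1.trans h2)
  refine h.core (fun i j => legw (d i) (o i) (n i) j) ?_ ?_ ?_ ?_ ?_
  · intro i j hj; simp [legw, hj]
  · intro i j hj
    have h1 := hp i j hj
    have h2 := hrange i
    rw [legw_abs _ _ _ _ hj]
    omega
  · intro i j i' j' hj hj' h1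
    rw [legw_abs _ _ _ _ hj, legw_abs _ _ _ _ hj'] at h1
    have h1' : legp (d i) (o i) (n i) j = legp (d i') (o i') (n i') j' := by exact_mod_cast h1
    have h2 := hp i j hj
    have h3 := hp i' j' hj'
    have h4 : i = i' := hblk i i' _ h2.1 h2.2 (h1' ▸ h3.1) (h1' ▸ h3.2)
    subst h4
    exact ⟨rfl, hpi i j j' hj hj' h1'⟩
  · intro i j hj
    rw [← hcd]
    rcases Nat.lt_or_ge (j+1) (n i) with h1 | h1
    · obtain ⟨l, _, _, _, _, h2⟩ := legw_int (d i) (o i) (n i) j h1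
      rw [h2]
      intro h3
      rw [h3] at hc4
      exact hc4 (altf_g l).1
    · rw [legw_leaf _ _ _ _ (by omega)]
      exact hcl i
  · intro i j i' j' hj hj' h0
    rcases Nat.lt_or_ge (j+1) (n i) with h1 | h1 <;>
    rcases Nat.lt_or_ge (j'+1) (n i') with h1' | h1'
    · obtain ⟨l, a1, a2, a3, a4, a5⟩ := legw_int (d i) (o i) (n i) j h1
      obtain ⟨l', b1, b2, b3, b4, b5⟩ := legw_int (d i') (o i') (n i') j' h1'
      rw [a5, b5] at h0
      have h2 := altf_g_inj _ _ h0
      subst h2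
      have h4 : i = i' := hblk i i' l a1 a2.le b1 b2.le
      subst h4
      refine ⟨rfl, ?_⟩
      cases hdi : d i
      · have := a4 hdi; have := b4 hdi; omega
      · have := a3 hdi; have := b3 hdi; omega
    · obtain ⟨l, a1, a2, a3, a4, a5⟩ := legw_int (d i) (o i) (n i) j h1
      rw [a5, legw_leaf _ _ _ _ (by omega)] at h0
      exact absurd h0 (hnl _ _ (by omega))
    · obtain ⟨l, a1, a2, a3, a4, a5⟩ := legw_int (d i') (o i') (n i') j' h1'
      rw [a5, legw_leaf _ _ _ _ (by omega)] at h0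
      exact absurd h0.symm (hnl _ _ (by omega))
    · rw [legw_leaf _ _ _ _ (by omega), legw_leaf _ _ _ _ (by omega)] at h0
      have h4 := hll _ _ h0
      subst h4
      exact ⟨rfl, by omega⟩

/-- Arithmetic condition under which one of the three labelings works. -/
def Good (x b c : ℕ) : Prop :=
  ((x + b + c) % 4 ≠ 3 ∧ (x + b) % 4 ≠ 3 ∧ ¬ (b % 2 = 0 ∧ c = 2 * x + 2)) ∨
  ((x + b + c) % 4 = 3 ∧ (x + b) % 4 ≠ 3 ∧ (x + b) % 4 ≠ 0 ∧ ((x + b) % 2 = 1 → x % 2 = 1)) ∨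
  (x % 4 = 3 ∧ b % 4 = 0 ∧ c % 4 = 0)

theorem good_exists (a b c : ℕ) (ha : 0 < a) (hb : 0 < b) (hc : 0 < c) :
    Good a b c ∨ Good a c b ∨ Good b a c ∨ Good b c a ∨ Good c a b ∨ Good c b a := by
  unfold Good
  by_contra hcon
  simp only [not_or] at hcon
  obtain ⟨⟨h1, h1', h1''⟩, ⟨h2, h2', h2''⟩, ⟨h3, h3', h3''⟩, ⟨h4, h4', h4''⟩, ⟨h5, h5', h5''⟩,
    ⟨h6, h6', h6''⟩⟩ := hcon
  by_cases hm : (a + b + c) % 4 = 3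
  · clear h1 h2 h3 h4 h5 h6
    have k1 : (a + b) % 4 = 3 ∨ (a + b) % 4 = 0 := by
      clear h2' h4' h5' h6' h1'' h2'' h3'' h4'' h5'' h6''; omega
    have k2 : (a + c) % 4 = 3 ∨ (a + c) % 4 = 0 := by
      clear h1' h3' h4' h6' h1'' h2'' h3'' h4'' h5'' h6''; omega
    have k3 : (b + c) % 4 = 3 ∨ (b + c) % 4 = 0 := by
      clear h1' h2' h3' h5' h1'' h2'' h3'' h4'' h5'' h6''; omega
    clear h1' h2' h3' h4' h5' h6' h2'' h4'' h6''
    rcases k1 with k1 | k1 <;> rcases k2 with k2 | k2 <;> rcases k3 with k3 | k3 <;> omega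
  · clear h1' h2' h3' h4' h5' h6' h1'' h2'' h3'' h4'' h5'' h6''
    have k1 : (a + b) % 4 = 3 ∨ (b % 2 = 0 ∧ c = 2 * a + 2 ∧ c = 2 * b + 2) := by
      clear h2 h4 h5 h6; omega
    have k2 : (a + c) % 4 = 3 ∨ (a % 2 = 0 ∧ b = 2 * a + 2 ∧ b = 2 * c + 2) := by
      clear h1 h3 h4 h6; omega
    have k3 : (b + c) % 4 = 3 ∨ (b % 2 = 0 ∧ a = 2 * b + 2 ∧ a = 2 * c + 2) := by
      clear h1 h2 h3 h5; omega
    clear h1 h2 h3 h4 h5 h6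
    rcases k1 with k1 | k1 <;> rcases k2 with k2 | k2 <;> rcases k3 with k3 | k3 <;> omega

theorem Spider.good {V : Type*} [DecidableEq V] {G : SimpleGraph V} [Fintype G.edgeSet]
    {L : Fin 3 → ℕ → V} {n : Fin 3 → ℕ} (h : Spider G L n) (hg : Good (n 0) (n 1) (n 2)) :
    HasAntimagicOrientation G := by
  have p0 := h.pos 0
  have p1 := h.pos 1
  have p2 := h.pos 2
  have hpp : ∀ i, ¬ (n i = 0) := fun i => (h.pos i).ne'
  rcases hg with hg | hg | hg
  · refine h.num ![0, n 0, n 0 + n 1] ![true, false, false] rfl rfl rfl _ rfl ?_ ?_ ?_ ?_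
    · simp [legw, altf, hpp]; split_ifs <;> omega
    · intro i; fin_cases i <;> simp [legw, legl, altf, hpp] <;> split_ifs <;> omega
    · intro i; fin_cases i <;> simp [legw, legl, altf, hpp] <;> split_ifs <;> omega
    · intro i i'; fin_cases i <;> fin_cases i' <;> simp [legw, legl, altf, hpp] <;>
        split_ifs <;> omega
  · refine h.num ![0, n 0, n 0 + n 1] ![true, false, true] rfl rfl rfl _ rfl ?_ ?_ ?_ ?_
    · simp [legw, altf, hpp]; split_ifs <;> omega
    · intro i; fin_cases i <;> simp [legw, legl, altf, hpp] <;> split_ifs <;> omega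
    · intro i; fin_cases i <;> simp [legw, legl, altf, hpp] <;> split_ifs <;> omega
    · intro i i'; fin_cases i <;> fin_cases i' <;> simp [legw, legl, altf, hpp] <;>
        split_ifs <;> omega
  · refine h.num ![0, n 0, n 0 + n 1] ![true, true, true] rfl rfl rfl _ rfl ?_ ?_ ?_ ?_
    · simp [legw, altf, hpp]; split_ifs <;> omega
    · intro i; fin_cases i <;> simp [legw, legl, altf, hpp] <;> split_ifs <;> omega
    · intro i; fin_cases i <;> simp [legw, legl, altf, hpp] <;> split_ifs <;> omega
    · intro i i'; fin_cases i <;> fin_cases i' <;> simp [legw, legl, altf, hpp] <;>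
        split_ifs <;> omega

theorem Spider.all {V : Type*} [DecidableEq V] {G : SimpleGraph V} [Fintype G.edgeSet]
    {L : Fin 3 → ℕ → V} {n : Fin 3 → ℕ} (h : Spider G L n) : HasAntimagicOrientation G := by
  have key : ∀ i j k : Fin 3, i ≠ j → i ≠ k → j ≠ k → Good (n i) (n j) (n k) →
      HasAntimagicOrientation G := by
    intro i j k hij hik hjk hg
    have hinj : Function.Injective ![i, j, k] := by
      intro a b; fin_cases a <;> fin_cases b <;> simp [hij, hik, hjk, hij.symm, hik.symm, hjk.symm]
    let σ : Equiv.Perm (Fin 3) := Equiv.ofBijective ![i, j, k] (Finite.injective_iff_bijective.1 hinj)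
    exact (h.perm σ).good hg
  rcases good_exists _ _ _ (h.pos 0) (h.pos 1) (h.pos 2) with g | g | g | g | g | g
  · exact key 0 1 2 (by decide) (by decide) (by decide) g
  · exact key 0 2 1 (by decide) (by decide) (by decide) g
  · exact key 1 0 2 (by decide) (by decide) (by decide) g
  · exact key 1 2 0 (by decide) (by decide) (by decide) g
  · exact key 2 0 1 (by decide) (by decide) (by decide) g
  · exact key 2 1 0 (by decide) (by decide) (by decide) g

/-- The legs of the one-legged subdivided caterpillar seen from the attaching vertex. -/
def catLeg (p k t : ℕ) (hk : 0 < k) (i : Fin 3) (j : ℕ) : Fin (p + 1) ⊕ Fin 1 × Fin k :=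
  if i = 0 then Sum.inl (Fin.ofNat (p + 1) (t - j))
  else if i = 1 then Sum.inl (Fin.ofNat (p + 1) (t + j))
  else if j = 0 then Sum.inl (Fin.ofNat (p + 1) t)
  else Sum.inr (0, ⟨(j - 1) % k, Nat.mod_lt _ hk⟩)

theorem cat_adj (p k : ℕ) (attach : Fin 1 → Fin (p + 1)) (u v) :
    (subdividedCaterpillar p 1 k attach).Adj u v ↔
      match u, v with
      | Sum.inl i, Sum.inl i' => (i : ℕ) + 1 = i' ∨ (i' : ℕ) + 1 = i
      | Sum.inl i, Sum.inr (_, j) => (i : ℕ) = attach 0 ∧ (j : ℕ) = 0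
      | Sum.inr (_, j), Sum.inl i => (i : ℕ) = attach 0 ∧ (j : ℕ) = 0
      | Sum.inr (_, j), Sum.inr (_, j') => (j : ℕ) + 1 = j' ∨ (j' : ℕ) + 1 = j := by
  unfold subdividedCaterpillar
  rw [SimpleGraph.fromRel_adj]
  rcases u with i | ⟨l, j⟩ <;> rcases v with i' | ⟨l', j'⟩
  · simp [Fin.ext_iff]; omega
  · obtain rfl := Subsingleton.elim l' 0
    simp [Fin.ext_iff]
  · obtain rfl := Subsingleton.elim l 0
    simp [Fin.ext_iff]
  · obtain rfl := Subsingleton.elim l 0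
    obtain rfl := Subsingleton.elim l' 0
    simp [Fin.ext_iff]; omega

theorem fin3 : ∀ i : Fin 3, i = 0 ∨ i = 1 ∨ i = 2 := by decide

theorem cat_spider (p k : ℕ) (hk : 0 < k) (attach : Fin 1 → Fin (p + 1))
    (h0 : 0 < (attach 0 : ℕ)) (h1 : (attach 0 : ℕ) < p) :
    Spider (subdividedCaterpillar p 1 k attach) (catLeg p k (attach 0 : ℕ) hk)
      ![(attach 0 : ℕ), p - attach 0, k] := by
  set t : ℕ := (attach 0 : ℕ) with ht
  have e0 : ∀ j, j ≤ t → catLeg p k t hk 0 j = Sum.inl ⟨t - j, by omega⟩ := by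
    intro j hj
    simp only [catLeg, if_true]
    congr 1
    exact Fin.ext (Nat.mod_eq_of_lt (by omega))
  have e1 : ∀ j (hj : j ≤ p - t), catLeg p k t hk 1 j = Sum.inl ⟨t + j, by omega⟩ := by
    intro j hj
    simp only [catLeg, if_true]
    rw [if_neg (by decide)]
    congr 1
    exact Fin.ext (Nat.mod_eq_of_lt (by omega))
  have e2 : catLeg p k t hk 2 0 = Sum.inl ⟨t, by omega⟩ := by
    simp only [catLeg, if_true]
    rw [if_neg (by decide), if_neg (by decide)]
    congr 1
    exact Fin.ext (Nat.mod_eq_of_lt (by omega))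
  have e3 : ∀ j (hj : j < k), catLeg p k t hk 2 (j+1) = Sum.inr (0, ⟨j, hj⟩) := by
    intro j hj
    simp only [catLeg]
    rw [if_neg (by decide), if_neg (by decide), if_neg (by omega)]
    congr 2
    exact Fin.ext (Nat.mod_eq_of_lt (by omega))
  have n0 : (![t, p - t, k] : Fin 3 → ℕ) 0 = t := rfl
  have n1 : (![t, p - t, k] : Fin 3 → ℕ) 1 = p - t := rfl
  have n2 : (![t, p - t, k] : Fin 3 → ℕ) 2 = k := rfl
  constructor
  · rw [Fin.forall_fin_succ, Fin.forall_fin_succ, Fin.forall_fin_succ]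
    simp; omega
  · intro i
    rw [e0 0 (by omega)]
    have : i = 0 ∨ i = 1 ∨ i = 2 := by omega
    rcases this with rfl | rfl | rfl
    · rw [e0 0 (by omega)]
    · rw [e1 0 (by omega)]; simp
    · rw [e2]; simp
  · intro i j i' j' hj hj' h
    have hi := fin3 i
    have hi' := fin3 i'
    rcases hi with rfl | rfl | rfl <;> rcases hi' with rfl | rfl | rfl <;>
      simp only [n0, n1, n2] at hj hj'
    · rw [e0 _ hj, e0 _ hj'] at h; simp at h; right; constructor; rfl; omega
    · rw [e0 _ hj, e1 _ hj'] at h; simp at h; omega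
    · rw [e0 _ hj] at h
      cases j' with
      | zero => rw [e2] at h; simp at h; omega
      | succ j' => rw [e3 _ hj'] at h; simp at h
    · rw [e1 _ hj, e0 _ hj'] at h; simp at h; omega
    · rw [e1 _ hj, e1 _ hj'] at h; simp at h; right; constructor; rfl; omega
    · rw [e1 _ hj] at h
      cases j' with
      | zero => rw [e2] at h; simp at h; omega
      | succ j' => rw [e3 _ hj'] at h; simp at h
    · rw [e0 _ hj'] at h
      cases j with
      | zero => rw [e2] at h; simp at h; omega
      | succ j => rw [e3 _ hj] at h; simp at h
    · rw [e1 _ hj'] at h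
      cases j with
      | zero => rw [e2] at h; simp at h; omega
      | succ j => rw [e3 _ hj] at h; simp at h
    · cases j with
      | zero =>
        cases j' with
        | zero => simp
        | succ j' => rw [e2, e3 _ hj'] at h; simp at h
      | succ j =>
        cases j' with
        | zero => rw [e2, e3 _ hj] at h; simp at h
        | succ j' => rw [e3 _ hj, e3 _ hj'] at h; simp at h; right; constructor; rfl; omega
  · rintro (⟨i, hi⟩ | ⟨l, ⟨j, hj⟩⟩)
    · rcases Nat.lt_or_ge i t with h | h
      · refine ⟨0, t - i, by rw [n0]; omega, ?_⟩
        rw [e0 _ (by omega)]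
        congr 2; omega
      · refine ⟨1, i - t, by rw [n1]; omega, ?_⟩
        rw [e1 _ (by omega)]
        congr 2; omega
    · obtain rfl := Subsingleton.elim l 0
      exact ⟨2, j + 1, by rw [n2]; omega, (e3 j hj).symm⟩
  · have hright : ∀ i j, j < (![t, p - t, k] : Fin 3 → ℕ) i →
        (subdividedCaterpillar p 1 k attach).Adj (catLeg p k t hk i j) (catLeg p k t hk i (j+1)) := by
      intro i j hj
      rw [cat_adj]
      have hi := fin3 i
      rcases hi with rfl | rfl | rfl <;> simp only [n0, n1, n2] at hj
      · rw [e0 _ (by omega), e0 _ (by omega)]; simp; omega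
      · rw [e1 _ (by omega), e1 _ (by omega)]; simp; omega
      · cases j with
        | zero => rw [e2, e3 _ hj]; simp [ht]
        | succ j => rw [e3 _ (by omega), e3 _ hj]; simp
    have hsp : ∀ (i : ℕ) (hi : i + 1 < p + 1), ∃ a b, b < (![t, p - t, k] : Fin 3 → ℕ) a ∧
        (((Sum.inl ⟨i, by omega⟩ : Fin (p + 1) ⊕ Fin 1 × Fin k) = catLeg p k t hk a b ∧
          (Sum.inl ⟨i + 1, hi⟩ : Fin (p + 1) ⊕ Fin 1 × Fin k) = catLeg p k t hk a (b+1)) ∨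
        ((Sum.inl ⟨i + 1, hi⟩ : Fin (p + 1) ⊕ Fin 1 × Fin k) = catLeg p k t hk a b ∧
          (Sum.inl ⟨i, by omega⟩ : Fin (p + 1) ⊕ Fin 1 × Fin k) = catLeg p k t hk a (b+1))) := by
      intro i hi
      rcases Nat.lt_or_ge i t with h | h
      · refine ⟨0, t - (i + 1), by rw [n0]; omega, Or.inr ?_⟩
        rw [e0 _ (by omega), e0 _ (by omega)]
        simp; omega
      · refine ⟨1, i - t, by rw [n1]; omega, Or.inl ?_⟩
        rw [e1 _ (by omega), e1 _ (by omega)]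
        simp; omega
    intro u v
    constructor
    · rw [cat_adj]
      rcases u with ⟨i, hi⟩ | ⟨l, ⟨j, hj⟩⟩ <;> rcases v with ⟨i', hi'⟩ | ⟨l', ⟨j', hj'⟩⟩ <;> simp only
      · rintro (rfl | rfl)
        · exact hsp i hi'
        · obtain ⟨a, b, h2, h3⟩ := hsp i' hi
          exact ⟨a, b, h2, h3.symm⟩
      · rintro ⟨h2, rfl⟩
        obtain rfl := Subsingleton.elim l' 0
        refine ⟨2, 0, hk, Or.inl ⟨?_, (e3 0 hj').symm⟩⟩
        rw [e2]; congr 2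
      · rintro ⟨h2, rfl⟩
        obtain rfl := Subsingleton.elim l 0
        refine ⟨2, 0, hk, Or.inr ⟨?_, (e3 0 hj).symm⟩⟩
        rw [e2]; congr 2
      · obtain rfl := Subsingleton.elim l 0
        obtain rfl := Subsingleton.elim l' 0
        rintro (rfl | rfl)
        · exact ⟨2, j + 1, hj', Or.inl ⟨(e3 _ _).symm, (e3 _ _).symm⟩⟩
        · exact ⟨2, j' + 1, hj, Or.inr ⟨(e3 _ _).symm, (e3 _ _).symm⟩⟩
    · rintro ⟨i, j, hj, ⟨rfl, rfl⟩ | ⟨rfl, rfl⟩⟩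
      · exact hright i j hj
      · exact (hright i j hj).symm

/-- **Every subdivided caterpillar with exactly one leg admits an antimagic orientation.**
A subdivided caterpillar is (up to isomorphism) a graph obtained from a caterpillar,
i.e. a spine path `v_0 ⋯ v_p` (`p ≥ 2`) with pendant edges (legs) attached to internal
spine vertices, by subdividing every leg the same number of times, so that all legs
become paths of the same length `k ≥ 1`. -/
theorem subdividedCaterpillar_oneLeg_hasAntimagicOrientation
    {V : Type*} [DecidableEq V] (G : SimpleGraph V) [Fintype G.edgeSet]
    (p k : ℕ) (hp : 2 ≤ p) (hk : 1 ≤ k)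
    (attach : Fin 1 → Fin (p + 1))
    (hattach : ∀ i, 0 < (attach i : ℕ) ∧ (attach i : ℕ) < p)
    (hiso : Nonempty (G ≃g subdividedCaterpillar p 1 k attach)) :
    HasAntimagicOrientation G := by
  obtain ⟨φ⟩ := hiso
  exact ((cat_spider p k hk attach (hattach 0).1 (hattach 0).2).iso φ).all
end

section
/- Let p ≥ 2 be an integer, let P = v_0 v_1 ⋯ v_p be a path, and let U = {v_{h_1}, v_{h_2}, …, v_{h_t}} be a nonempty subset of the internal vertices of P, where 1 ≤ h_1 < h_2 < ⋯ < h_t ≤ p−1. Then P has an orientation D and a bijection τ from the arc set of D to {1,2,…,p} such that: (i) the vertex-sum of every vertex v ∈ U is at least 1; moreover, the vertex-sum of every v ∈ U with v ≠ v_{h_t} is at most p−1, and the vertex-sum of v_{h_t} is at least 3; (ii) for every vertex v ∈ V(P) \ U, the absolute value of its vertex-sum lies between 1 and p; and (iii) any two distinct vertices of V(P) \ U have distinct vertex-sums. -/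
/-- The vertex-sum of the vertex `v_v` of the path `v_0 v_1 ⋯ v_p` under an orientation
`dir` of its edges (edge `e` joins `v_e` and `v_{e+1}`; `dir e = true` means the arc is
`v_e → v_{e+1}`, and `dir e = false` means the arc is `v_{e+1} → v_e`) and an integer
labeling `lab` of the edges: the sum of the labels of arcs entering `v_v` minus the sum
of the labels of arcs leaving `v_v`. -/
def pathVertexSum (p : ℕ) (dir : Fin p → Bool) (lab : Fin p → ℤ) (v : Fin (p + 1)) : ℤ :=
  (∑ e : Fin p, if (dir e = true ∧ (e : ℕ) + 1 = (v : ℕ)) ∨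
      (dir e = false ∧ (e : ℕ) = (v : ℕ)) then lab e else 0)
  - ∑ e : Fin p, if (dir e = true ∧ (e : ℕ) = (v : ℕ)) ∨
      (dir e = false ∧ (e : ℕ) + 1 = (v : ℕ)) then lab e else 0

/-- difference attached to an interior vertex `j` -/
def plDiff (h : ℕ) (a : ℕ → ℤ) (j : ℕ) : ℤ :=
  if j < h then a j - a (j + 1) else a (j + 1) - a j

/-- partial labelings of the middle part of the path -/
def plGood (h : ℕ) (U : ℕ → Prop) (l r : ℕ) (lo hi X Y P N c : ℤ) : Prop :=
  ∃ a : ℕ → ℤ, a l = X ∧ a r = Y ∧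
    (∀ e, l < e → e < r → lo ≤ a e ∧ a e ≤ hi) ∧
    (∀ e f, l < e → e < r → l < f → f < r → a e = a f → e = f) ∧
    (∀ j, l ≤ j → j < h → U j → 1 ≤ plDiff h a j) ∧
    (∀ j, l ≤ j → j < r → j ≠ h → ¬ U j → plDiff h a j ≤ P ∧ -N ≤ plDiff h a j ∧
      plDiff h a j ≠ 0 ∧ (plDiff h a j < 0 → plDiff h a j ≤ -c)) ∧
    (∀ i j, l ≤ i → i < r → i ≠ h → ¬ U i → l ≤ j → j < r → j ≠ h → ¬ U j →
      plDiff h a i = plDiff h a j → i = j)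

theorem plGood_base (h : ℕ) (U : ℕ → Prop) (lo hi X Y P N c : ℤ) :
    plGood h U h (h+1) lo hi X Y P N c := by
  refine ⟨fun e => if e ≤ h then X else Y, by simp, by simp, ?_, ?_, ?_, ?_, ?_⟩ <;>
    intros <;> omega

theorem plGood_mono {h : ℕ} {U : ℕ → Prop} {l r : ℕ} {lo hi X Y P N c P' N' c' : ℤ}
    (H : plGood h U l r lo hi X Y P' N' c') (hP : P' ≤ P) (hN : N' ≤ N) (hc : c ≤ c') :
    plGood h U l r lo hi X Y P N c := by
  obtain ⟨a, h1, h2, h3, h4, h5, h6, h7⟩ := H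
  refine ⟨a, h1, h2, h3, h4, h5, ?_, h7⟩
  intro j a1 a2 a3 a4
  obtain ⟨b1, b2, b3, b4⟩ := h6 j a1 a2 a3 a4
  refine ⟨by omega, by omega, b3, fun hh => ?_⟩
  have := b4 hh
  omega

theorem plGood_stepX {h : ℕ} {U : ℕ → Prop} {l r : ℕ}
    {lo hi X Y P N c lo' hi' P' N' c' : ℤ} (X' : ℤ)
    (H : plGood h U (l+1) r lo' hi' X' Y P' N' c') (hl : l < h) (hr : h < r)
    (h1 : lo ≤ lo') (h2 : hi' ≤ hi) (h3 : lo ≤ X') (h4 : X' ≤ hi) (h5 : X' < lo' ∨ hi' < X')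
    (hP : P' ≤ P) (hN : N' ≤ N) (hc : c ≤ c')
    (hU : U l → 1 ≤ X - X')
    (hnU : ¬ U l → X - X' ≤ P ∧ -N ≤ X - X' ∧ X - X' ≠ 0 ∧ (X - X' < 0 → X - X' ≤ -c) ∧
      (0 < X - X' → P' < X - X') ∧ (X - X' < 0 → N' < -(X - X') ∨ -(X - X') < c')) :
    plGood h U l r lo hi X Y P N c := by
  obtain ⟨a, k1, k2, k3, k4, k5, k6, k7⟩ := plGood_mono H hP hN hc
  obtain ⟨a, k1, k2, k3, k4, k5, k6, k7⟩ := H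
  have hd : ∀ j, l + 1 ≤ j → plDiff h (Function.update a l X) j = plDiff h a j := by
    intro j hj
    simp only [plDiff]
    rw [Function.update_of_ne (by omega), Function.update_of_ne (by omega)]
  have hd0 : plDiff h (Function.update a l X) l = X - X' := by
    simp only [plDiff, if_pos hl]
    rw [Function.update_self, Function.update_of_ne (by omega), k1]
  have ha : ∀ j, l < j → Function.update a l X j = a j := fun j hj =>
    Function.update_of_ne (by omega) _ _
  refine ⟨Function.update a l X, by simp, by rw [ha r (by omega), k2], ?_, ?_, ?_, ?_, ?_⟩
  · intro e he her
    rw [ha e he]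
    rcases Nat.lt_or_ge (l+1) e with q | q
    · have := k3 e q her; omega
    · have : e = l + 1 := by omega
      subst this; omega
  · intro e f he her hf hfr
    rw [ha e he, ha f hf]
    intro hef
    rcases Nat.lt_or_ge (l+1) e with q | q <;> rcases Nat.lt_or_ge (l+1) f with q' | q'
    · exact k4 e f q her q' hfr hef
    · have : f = l + 1 := by omega
      subst this
      have := k3 e q her; omega
    · have : e = l + 1 := by omega
      subst this
      have := k3 f q' hfr; omega
    · omega
  · intro j hj hjh hUj
    rcases Nat.lt_or_ge l j with q | q
    · rw [hd j q]; exact k5 j q hjh hUj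
    · have : j = l := by omega
      subst this; rw [hd0]; exact hU hUj
  · intro j hj hjr hjh hUj
    rcases Nat.lt_or_ge l j with q | q
    · rw [hd j q]
      obtain ⟨b1, b2, b3, b4⟩ := k6 j q hjr hjh hUj
      refine ⟨by omega, by omega, b3, fun hh => ?_⟩
      have := b4 hh
      omega
    · have : j = l := by omega
      subst this; rw [hd0]
      obtain ⟨b1, b2, b3, b4, b5⟩ := hnU hUj
      exact ⟨b1, b2, b3, b4⟩
  · have key : ∀ j, l < j → j < r → j ≠ h → ¬ U j → ¬ U l → plDiff h a j ≠ X - X' := by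
      intro j q hjr hjh hUj hUl hh
      obtain ⟨b1, b2, b3, b4⟩ := k6 j q hjr hjh hUj
      obtain ⟨c1, c2, c3, c4, c5, c6⟩ := hnU hUl
      rw [hh] at b1 b2 b3 b4
      rcases lt_or_gt_of_ne c3 with q | q
      · have := c6 q; have := b4 q; omega
      · have := c5 q; omega
    intro i j hi1 hi2 hi3 hi4 hj1 hj2 hj3 hj4 hij
    rcases Nat.lt_or_ge l i with q | q <;> rcases Nat.lt_or_ge l j with q' | q'
    · rw [hd i q, hd j q'] at hij
      exact k7 i j q hi2 hi3 hi4 q' hj2 hj3 hj4 hij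
    · have : j = l := by omega
      subst this
      rw [hd i q, hd0] at hij
      exact absurd hij (key i q hi2 hi3 hi4 hj4)
    · have : i = l := by omega
      subst this
      rw [hd j q', hd0] at hij
      exact absurd hij.symm (key j q' hj2 hj3 hj4 hi4)
    · omega

theorem plGood_stepY {h : ℕ} {U : ℕ → Prop} {l r : ℕ}
    {lo hi X Y P N c lo' hi' P' N' c' : ℤ} (Y' : ℤ)
    (H : plGood h U l r lo' hi' X Y' P' N' c') (hl : l ≤ h) (hr : h < r)
    (h1 : lo ≤ lo') (h2 : hi' ≤ hi) (h3 : lo ≤ Y') (h4 : Y' ≤ hi) (h5 : Y' < lo' ∨ hi' < Y')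
    (hP : P' ≤ P) (hN : N' ≤ N) (hc : c ≤ c')
    (hnU : Y - Y' ≤ P ∧ -N ≤ Y - Y' ∧ Y - Y' ≠ 0 ∧ (Y - Y' < 0 → Y - Y' ≤ -c) ∧
      (0 < Y - Y' → P' < Y - Y') ∧ (Y - Y' < 0 → N' < -(Y - Y') ∨ -(Y - Y') < c')) :
    plGood h U l (r+1) lo hi X Y P N c := by
  obtain ⟨a, k1, k2, k3, k4, k5, k6, k7⟩ := H
  have hd : ∀ j, j < r → plDiff h (Function.update a (r+1) Y) j = plDiff h a j := by
    intro j hj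
    simp only [plDiff]
    rw [Function.update_of_ne (by omega), Function.update_of_ne (by omega)]
  have hd0 : plDiff h (Function.update a (r+1) Y) r = Y - Y' := by
    simp only [plDiff, if_neg (show ¬ r < h by omega)]
    rw [Function.update_self, Function.update_of_ne (by omega), k2]
  have ha : ∀ j, j < r + 1 → Function.update a (r+1) Y j = a j := fun j hj =>
    Function.update_of_ne (by omega) _ _
  refine ⟨Function.update a (r+1) Y, by rw [ha l (by omega), k1], by simp, ?_, ?_, ?_, ?_, ?_⟩
  · intro e he her
    rw [ha e her]
    rcases Nat.lt_or_ge e r with q | q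
    · have := k3 e he q; omega
    · have : e = r := by omega
      subst this; omega
  · intro e f he her hf hfr
    rw [ha e her, ha f hfr]
    intro hef
    rcases Nat.lt_or_ge e r with q | q <;> rcases Nat.lt_or_ge f r with q' | q'
    · exact k4 e f he q hf q' hef
    · have : f = r := by omega
      subst this
      have := k3 e he q; omega
    · have : e = r := by omega
      subst this
      have := k3 f hf q'; omega
    · omega
  · intro j hj hjh hUj
    rw [hd j (by omega)]; exact k5 j hj hjh hUj
  · intro j hj hjr hjh hUj
    rcases Nat.lt_or_ge j r with q | q
    · rw [hd j q]
      obtain ⟨b1, b2, b3, b4⟩ := k6 j hj q hjh hUj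
      refine ⟨by omega, by omega, b3, fun hh => ?_⟩
      have := b4 hh
      omega
    · have : j = r := by omega
      subst this; rw [hd0]
      obtain ⟨b1, b2, b3, b4, b5⟩ := hnU
      exact ⟨b1, b2, b3, b4⟩
  · have key : ∀ j, l ≤ j → j < r → j ≠ h → ¬ U j → plDiff h a j ≠ Y - Y' := by
      intro j q hjr hjh hUj hh
      obtain ⟨b1, b2, b3, b4⟩ := k6 j q hjr hjh hUj
      obtain ⟨c1, c2, c3, c4, c5, c6⟩ := hnU
      rw [hh] at b1 b2 b3 b4
      rcases lt_or_gt_of_ne c3 with q | q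
      · have := c6 q; have := b4 q; omega
      · have := c5 q; omega
    intro i j hi1 hi2 hi3 hi4 hj1 hj2 hj3 hj4 hij
    rcases Nat.lt_or_ge i r with q | q <;> rcases Nat.lt_or_ge j r with q' | q'
    · rw [hd i q, hd j q'] at hij
      exact k7 i j hi1 q hi3 hi4 hj1 q' hj3 hj4 hij
    · have : j = r := by omega
      subst this
      rw [hd i q, hd0] at hij
      exact absurd hij (key i hi1 q hi3 hi4)
    · have : i = r := by omega
      subst this
      rw [hd j q', hd0] at hij
      exact absurd hij.symm (key j hj1 q' hj3 hj4)
    · omega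

/-- type function for the left strand: `T j` means edge `j` carries a high label -/
def plType (h : ℕ) (U T : ℕ → Prop) : Prop :=
  ∀ j, j < h → (U j → T j) ∧ (¬ U j → (T j ↔ ¬ T (j+1)))

theorem plType_exists (h : ℕ) (U : ℕ → Prop) : ∃ T : ℕ → Prop, plType h U T ∧ ¬ T h := by
  let s : ℕ → Prop := fun k => Nat.rec False (fun k ih => U (h - (k+1)) ∨ ¬ ih) k
  have hs : ∀ k, s (k+1) = (U (h - (k+1)) ∨ ¬ s k) := fun k => rfl
  refine ⟨fun j => s (h - j), ?_, ?_⟩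
  · intro j hj
    obtain ⟨k, rfl⟩ : ∃ k, h = j + k + 1 := ⟨h - j - 1, by omega⟩
    have e1 : j + k + 1 - j = k + 1 := by omega
    have e2 : j + k + 1 - (j + 1) = k := by omega
    have e3 : j + k + 1 - (k + 1) = j := by omega
    simp only [e1, e2, hs, e3]
    tauto
  · simp [s]

theorem plGood_soloX (h : ℕ) (U T : ℕ → Prop) (hT : plType h U T) (c : ℤ) 
    (hc : c = 1 ∨ c = 2 ∧ ¬ T h) (Y : ℤ) :
    ∀ (n l : ℕ) (lo hi X : ℤ), l + n = h → hi = lo + n - 1 →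
    (l < h → U l → hi < X) → (l < h → ¬ U l → (T l → X = hi + 1) ∧ (¬ T l → X = lo - 1)) →
    plGood h U l (h+1) lo hi X Y n n c := by
  intro n
  induction n with
  | zero =>
    intro l lo hi X h1 _ _ _
    have : l = h := by omega
    subst this
    exact plGood_base _ _ _ _ _ _ _ _ _
  | succ n ih =>
    intro l lo hi X h1 h2 h3 h4
    have hlt : l < h := by omega
    obtain ⟨t1, t2⟩ := hT l hlt
    have h3 := h3 hlt
    have h4 := h4 hlt
    push_cast at h2 ⊢
    have hfin : n = 0 → l + 1 = h := by omega
    by_cases hT' : T (l+1)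
    · refine plGood_stepX (lo' := lo) (hi' := hi - 1) (P' := n) (N' := n) (c' := c) hi
        (ih (l+1) lo (hi-1) hi (by omega) (by omega) (by omega) ?_) hlt (by omega)
        (by omega) (by omega) (by omega) (by omega) (by omega) (by omega) (by omega) (by omega)
        ?_ ?_
      · exact fun _ _ => ⟨fun _ => by omega, fun q => absurd hT' q⟩
      · intro hu; have := h3 hu; omega
      · intro hu
        have e := (h4 hu).2 (by have := t2 hu; tauto)
        have : c = 2 → n ≠ 0 := by
          rintro hc2 hn
          have := hfin hn
          rcases hc with hc | hc
          · omega
          · exact hc.2 (this ▸ hT')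
        rcases hc with hc | hc
        · omega
        · have := this hc.1; omega
    · refine plGood_stepX (lo' := lo+1) (hi' := hi) (P' := n) (N' := n) (c' := c) lo
        (ih (l+1) (lo+1) hi lo (by omega) (by omega) ?_ ?_) hlt (by omega)
        (by omega) (by omega) (by omega) (by omega) (by omega) (by omega) (by omega) (by omega)
        ?_ ?_
      · intro q hu; exact absurd ((hT (l+1) q).1 hu) hT'
      · exact fun _ _ => ⟨fun q => absurd q hT', fun _ => by omega⟩
      · intro hu; have := h3 hu; omega
      · intro hu
        have e := (h4 hu).1 (by have := t2 hu; tauto)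
        omega

theorem plGood_soloY (h : ℕ) (U T : ℕ → Prop) (hT : plType h U T) (c : ℤ) (g : ℕ) (hgh : g ≤ h)
    (hg : g < h → U g) (hc : c = 1 ∨ c = 2 ∧ ¬ T h ∧ g < h) :
    ∀ (n r : ℕ) (lo hi X Y P N : ℤ), g + n + 1 = r → hi = lo + n - 1 → h < r →
    (g < h → hi < X) →
    (Y = hi + 1 ∨ Y = hi + 2) ∧ Y - lo ≤ P ∧ n ≤ N ∨
      (Y = lo - 1 ∨ Y = lo - 2) ∧ hi - Y ≤ N ∧ n ≤ P →
    plGood h U g r lo hi X Y P N c := by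
  intro n
  induction n with
  | zero =>
    intro r lo hi X Y P N h1 h2 h3 h4 h5
    have : g = h := by omega
    subst this
    have : r = g + 1 := by omega
    subst this
    exact plGood_base _ _ _ _ _ _ _ _ _
  | succ n ih =>
    intro r lo hi X Y P N h1 h2 h3 h4 h5
    push_cast at h2 h5
    rcases Nat.lt_or_ge (h+1) r with q | q
    · obtain ⟨r, rfl⟩ : ∃ r', r = r' + 1 := ⟨r - 1, by omega⟩
      rcases h5 with h5 | h5
      · exact plGood_stepY (lo' := lo + 1) (hi' := hi) (P' := n) (N' := n) (c' := c) lo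
          (ih r (lo+1) hi X lo n n (by omega) (by omega) (by omega) (by omega) (by omega))
          (by omega) (by omega) (by omega) (by omega) (by omega) (by omega) (by omega) (by omega)
          (by omega) (by omega) (by omega)
      · exact plGood_stepY (lo' := lo) (hi' := hi - 1) (P' := n) (N' := n) (c' := c) hi
          (ih r lo (hi-1) X hi n n (by omega) (by omega) (by omega) (by omega) (by omega))
          (by omega) (by omega) (by omega) (by omega) (by omega) (by omega) (by omega) (by omega)
          (by omega) (by omega) (by omega)
    · have : r = h + 1 := by omega
      subst this
      refine plGood_mono (plGood_soloX h U T hT c (by tauto) Y (n+1) g lo hi X (by omega)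
        (by push_cast; omega) (fun a _ => h4 a) (fun a b => absurd (hg a) b)) ?_ ?_ le_rfl
      · push_cast; omega
      · push_cast; omega

set_option maxHeartbeats 4000000 in
theorem plGood_two (h : ℕ) (U T : ℕ → Prop) (hT : plType h U T) (c : ℤ) (g : ℕ) (hgh : g ≤ h)
    (hg : g < h → U g) (hc : c = 1 ∨ c = 2 ∧ ¬ T h ∧ g < h) :
    ∀ (m n l r : ℕ) (lo hi X Y P N : ℤ), n ≤ m → l + n + 1 = r → hi = lo + n - 1 → h < r → l ≤ g →
    (T l ∧ X = hi + 1 ∧ (Y = lo - 1 ∧ n ≤ P ∧ n ≤ N ∨ (Y = hi + 1 ∨ Y = hi + 2) ∧ n + 1 ≤ P ∧ n ≤ N) ∨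
     ¬ T l ∧ X = lo - 1 ∧ (Y = hi + 1 ∧ n ≤ P ∧ n ≤ N ∨ (Y = lo - 1 ∨ Y = lo - 2) ∧
        hi - Y ≤ N ∧ n ≤ P ∧ n ≤ N)) →
    plGood h U l r lo hi X Y P N c := by
  intro m
  induction m with
  | zero =>
    intro n l r lo hi X Y P N h0 h1 h2 h3 h4 h5
    have : l = h := by omega
    subst this
    have : r = l + 1 := by omega
    subst this
    exact plGood_base _ _ _ _ _ _ _ _ _
  | succ m ih =>
    intro n l r lo hi X Y P N h0 h1 h2 h3 h4 h5
    rcases Nat.lt_or_ge l g with hl | hl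
    swap
    · have : l = g := by omega
      subst this
      refine plGood_soloY h U T hT c l hgh hg hc n r lo hi X Y P N h1 h2 h3 ?_ ?_
      · intro q
        have := (hT l q).1 (hg q)
        rcases h5 with h5 | h5
        · omega
        · exact absurd this h5.1
      · omega
    have hlh : l < h := by omega
    obtain ⟨t1, t2⟩ := hT l hlh
    rcases Nat.lt_or_ge (h+1) r with q | q
    swap
    · have : r = h + 1 := by omega
      subst this
      refine plGood_mono (plGood_soloX h U T hT c (by tauto) Y n l lo hi X (by omega)
        (by omega) ?_ ?_) ?_ ?_ le_rfl
      · intro _ hu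
        have := t1 hu
        rcases h5 with h5 | h5
        · omega
        · exact absurd this h5.1
      · intro _ hu
        constructor
        · intro ht
          rcases h5 with h5 | h5
          · omega
          · exact absurd ht h5.1
        · intro ht
          rcases h5 with h5 | h5
          · exact absurd h5.1 ht
          · omega
      · omega
      · omega
    obtain ⟨r, rfl⟩ : ∃ r', r = r' + 1 := ⟨r - 1, by omega⟩
    obtain ⟨n, rfl⟩ : ∃ n', n = n' + 2 := ⟨n - 2, by omega⟩
    push_cast at h2 h5
    have hc2 : c = 2 → 1 ≤ n := by omega
    have hc12 : c = 1 ∨ c = 2 := by omega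
    have fin : ∀ (X' Y' lo1 hi1 lo' hi' P1 N1 P' N' : ℤ),
        (T (l+1) ∧ X' = hi' + 1 ∧ (Y' = lo' - 1 ∧ n ≤ P' ∧ n ≤ N' ∨
            (Y' = hi' + 1 ∨ Y' = hi' + 2) ∧ n + 1 ≤ P' ∧ n ≤ N') ∨
          ¬ T (l+1) ∧ X' = lo' - 1 ∧ (Y' = hi' + 1 ∧ n ≤ P' ∧ n ≤ N' ∨
            (Y' = lo' - 1 ∨ Y' = lo' - 2) ∧ hi' - Y' ≤ N' ∧ n ≤ P' ∧ n ≤ N')) →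
        hi' = lo' + n - 1 → lo1 ≤ lo' → hi' ≤ hi1 → lo1 ≤ X' → X' ≤ hi1 → (X' < lo' ∨ hi' < X') →
        lo ≤ lo1 → hi1 ≤ hi → lo ≤ Y' → Y' ≤ hi → (Y' < lo1 ∨ hi1 < Y') →
        P' ≤ P1 → N' ≤ N1 → P1 ≤ P → N1 ≤ N →
        (U l → 1 ≤ X - X') →
        (¬ U l → X - X' ≤ P1 ∧ -N1 ≤ X - X' ∧ X - X' ≠ 0 ∧ (X - X' < 0 → X - X' ≤ -c) ∧
          (0 < X - X' → P' < X - X') ∧ (X - X' < 0 → N' < -(X - X') ∨ -(X - X') < c)) →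
        (Y - Y' ≤ P ∧ -N ≤ Y - Y' ∧ Y - Y' ≠ 0 ∧ (Y - Y' < 0 → Y - Y' ≤ -c) ∧
          (0 < Y - Y' → P1 < Y - Y') ∧ (Y - Y' < 0 → N1 < -(Y - Y') ∨ -(Y - Y') < c)) →
        plGood h U l (r+1) lo hi X Y P N c := by
      intro X' Y' lo1 hi1 lo' hi' P1 N1 P' N' a1 a2 a3 a4 a5 a6 a7 a8 a9 a10 a11 a12 a13 a14 a15
        a16 a17 a18 a19
      refine plGood_stepY (lo' := lo1) (hi' := hi1) (P' := P1) (N' := N1) (c' := c) Y'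
        (plGood_stepX (lo' := lo') (hi' := hi') (P' := P') (N' := N') (c' := c) X'
          (ih n (l+1) r lo' hi' X' Y' P' N' (by omega) (by omega) a2 (by omega) (by omega) a1)
          hlh (by omega) a3 a4 a5 a6 a7 a13 a14 le_rfl a17 a18)
        (by omega) (by omega) a8 a9 a10 a11 a12 a15 a16 le_rfl a19
    rcases h5 with ⟨ht, hX, ⟨hY, hP, hN⟩ | ⟨hY, hP, hN⟩⟩ | ⟨ht, hX, ⟨hY, hP, hN⟩ | ⟨hY, hN', hP, hN⟩⟩
    · -- X high, Y low
      by_cases hT' : T (l+1)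
      · have hu : U l := by by_contra hu; have := t2 hu; tauto
        apply fin (hi-1) hi lo (hi-1) lo (hi-2) (n+1) n (n+1) n
        · left; exact ⟨hT', by omega, by omega⟩
        all_goals first | omega | (intro hh; first | omega | exact absurd hu hh)
      · apply fin lo hi lo (hi-1) (lo+1) (hi-1) (n+2) n n n
        · right; exact ⟨hT', by omega, by omega⟩
        all_goals first | omega | (intro hh; first | omega | exact absurd hu hh)
    · -- both high
      by_cases hT' : T (l+1)
      · have hu : U l := by by_contra hu; have := t2 hu; tauto
        apply fin hi lo (lo+1) hi (lo+1) (hi-1) n n n n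
        · left; exact ⟨hT', by omega, by omega⟩
        all_goals first | omega | (intro hh; first | omega | exact absurd hu hh)
      · apply fin (lo+1) lo (lo+1) hi (lo+2) hi (n+1) (n+1) n (n+1)
        · right; exact ⟨hT', by omega, by omega⟩
        all_goals first | omega | (intro hh; first | omega | exact absurd hu hh)
    · -- X low, Y high
      have hu : ¬ U l := fun hu => ht (t1 hu)
      have hT' : T (l+1) := by have := t2 hu; tauto
      apply fin hi lo (lo+1) hi (lo+1) (hi-1) n (n+2) n n
      · left; exact ⟨hT', by omega, by omega⟩
      all_goals first | omega | (intro hh; first | omega | exact absurd hh hu)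
    · -- both low
      have hu : ¬ U l := fun hu => ht (t1 hu)
      have hT' : T (l+1) := by have := t2 hu; tauto
      apply fin (hi-1) hi lo (hi-1) lo (hi-2) (n+1) (n+1) (n+1) n
      · left; exact ⟨hT', by omega, by omega⟩
      all_goals first | omega | (intro hh; first | omega | exact absurd hh hu)

theorem plGood_main (p h : ℕ) (U : ℕ → Prop) (h1 : 1 ≤ h) (h2 : h < p) (hU0 : ¬ U 0) :
    plGood h U 0 (p+1) 1 p 0 0 p p 1 := by
  obtain ⟨T, hT, hTh⟩ := plType_exists h U
  by_cases ht : T 0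
  swap
  · apply plGood_two h U T hT 1 h le_rfl (by omega) (by omega) p p <;> try omega
    right
    exact ⟨ht, by omega, by omega⟩
  by_cases hg : ∃ g, g < h ∧ U g
  · obtain ⟨g, hg, hUg⟩ := hg
    have hg0 : g ≠ 0 := by rintro rfl; exact hU0 hUg
    have hT1 : ¬ T 1 := ((hT 0 h1).2 hU0).1 ht
    have A : plGood h U 1 p 2 (p-1) 1 p (p-2) (p-2) 2 := by
      apply plGood_two h U T hT 2 g hg.le (fun _ => hUg) (Or.inr ⟨rfl, hTh, hg⟩) p (p-2) <;>
        try omega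
      right
      exact ⟨hT1, by omega, by omega⟩
    have B : plGood h U 1 (p+1) 2 p 1 0 (p-2) p 2 := by
      apply plGood_stepY _ A <;> omega
    apply plGood_stepX _ B <;> first | omega | exact fun q => absurd q hU0
  · have hT2 : plType h U (fun j => ¬ T j) := by
      intro j hj
      have hu : ¬ U j := fun hu => hg ⟨j, hj, hu⟩
      have := (hT j hj).2 hu
      tauto
    apply plGood_two h U _ hT2 1 h le_rfl (by omega) (by omega) p p <;> try omega
    right
    exact ⟨by simpa using ht, by omega, by omega⟩

theorem pl_sum (p h : ℕ) (a : ℕ → ℤ) (a0 : a 0 = 0) (ap : a (p+1) = 0) (v : Fin (p+1)) :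
    pathVertexSum p (fun e => decide ((e:ℕ) < h)) (fun e => a ((e:ℕ)+1)) v
      = (if (v:ℕ) ≤ h then a v else - a v) - (if (v:ℕ) < h then a (v+1) else - a (v+1)) := by
  unfold pathVertexSum
  rw [← Finset.sum_sub_distrib]
  have e1 : ∀ e : Fin p, ((if (decide ((e:ℕ) < h) = true ∧ (e : ℕ) + 1 = (v : ℕ)) ∨
      (decide ((e:ℕ) < h) = false ∧ (e : ℕ) = (v : ℕ)) then a ((e:ℕ)+1) else 0)
      - if (decide ((e:ℕ) < h) = true ∧ (e : ℕ) = (v : ℕ)) ∨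
      (decide ((e:ℕ) < h) = false ∧ (e : ℕ) + 1 = (v : ℕ)) then a ((e:ℕ)+1) else 0)
      = (if (v:ℕ) = (e:ℕ)+1 then (if (v:ℕ) ≤ h then a v else - a v) else 0)
        - (if (v:ℕ) = (e:ℕ) then (if (v:ℕ) < h then a (v+1) else - a (v+1)) else 0) := by
    intro e
    simp only [decide_eq_true_eq, decide_eq_false_iff_not]
    by_cases q1 : (v:ℕ) = (e:ℕ)+1
    · rw [q1]; by_cases q : (e:ℕ) < h <;> simp [q, Nat.succ_le_iff]
    · by_cases q2 : (v:ℕ) = (e:ℕ)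
      · rw [q2]; by_cases q : (e:ℕ) < h <;> simp [q]
      · have q1' : ¬ (e:ℕ)+1 = v := fun q => q1 q.symm
        have q2' : ¬ (e:ℕ) = v := fun q => q2 q.symm
        simp [q1, q2, q1', q2']
  rw [Finset.sum_congr rfl (fun e _ => e1 e), Finset.sum_sub_distrib]
  have hv := v.2
  congr 1
  · rw [Fin.sum_univ_eq_sum_range (fun e => if (v:ℕ) = e + 1 then
      (if (v:ℕ) ≤ h then a v else - a v) else 0) p]
    rcases Nat.eq_zero_or_pos (v:ℕ) with q | q
    · rw [q]; simp [a0]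
    · rw [Finset.sum_eq_single ((v:ℕ)-1)]
      · rw [if_pos (by omega)]
      · intro b _ hb; rw [if_neg (by omega)]
      · intro hb; simp at hb; omega
  · rw [Fin.sum_univ_eq_sum_range (fun e => if (v:ℕ) = e then
      (if (v:ℕ) < h then a (v+1) else - a (v+1)) else 0) p]
    rw [Finset.sum_ite_eq]
    split_ifs with q1 q2 q2
    · rfl
    · rfl
    · have : (v:ℕ) = p := by simp at q1; omega
      rw [this, ap]
    · have : (v:ℕ) = p := by simp at q1; omega
      rw [this, ap]; rfl

theorem path_orientation_labeling (p : ℕ) (hp : 2 ≤ p)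
    (U : Finset (Fin (p + 1))) (hU : U.Nonempty)
    (hUint : ∀ v ∈ U, 0 < (v : ℕ) ∧ (v : ℕ) < p) :
    ∃ (dir : Fin p → Bool) (lab : Fin p → ℤ),
      Set.BijOn lab Set.univ (Set.Icc 1 (p : ℤ)) ∧
      (∀ v ∈ U, 1 ≤ pathVertexSum p dir lab v) ∧
      (∀ v ∈ U, v ≠ U.max' hU → pathVertexSum p dir lab v ≤ (p : ℤ) - 1) ∧
      3 ≤ pathVertexSum p dir lab (U.max' hU) ∧
      (∀ v : Fin (p + 1), v ∉ U →
        1 ≤ |pathVertexSum p dir lab v| ∧ |pathVertexSum p dir lab v| ≤ (p : ℤ)) ∧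
      (∀ u v : Fin (p + 1), u ∉ U → v ∉ U → u ≠ v →
        pathVertexSum p dir lab u ≠ pathVertexSum p dir lab v) := by
  have hM := U.max'_mem hU
  have hmax : ∀ v ∈ U, (v:ℕ) ≤ (U.max' hU : ℕ) := fun v hv => U.le_max' v hv
  generalize U.max' hU = M at hM hmax ⊢
  obtain ⟨hM1, hM2⟩ := hUint M hM
  obtain ⟨a, k1, k2, k3, k4, k5, k6, k7⟩ := plGood_main p M (fun j => ∃ v ∈ U, (v:ℕ) = j)
    hM1 hM2 (by rintro ⟨v, hv, h0⟩; have := hUint v hv; omega)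
  have hs := pl_sum p M a k1 k2
  have hsM : pathVertexSum p (fun e => decide ((e:ℕ) < (M:ℕ))) (fun e => a ((e:ℕ)+1)) M
      = a M + a (M+1) := by
    rw [hs M]; simp
  have hsd : ∀ v : Fin (p+1), v ≠ M →
      pathVertexSum p (fun e => decide ((e:ℕ) < (M:ℕ))) (fun e => a ((e:ℕ)+1)) v
      = plDiff M a v := by
    intro v hv
    have hv' : (v:ℕ) ≠ M := fun q => hv (Fin.ext q)
    rw [hs v, plDiff]
    by_cases q : (v:ℕ) < M
    · simp [q, q.le]
    · rw [if_neg q, if_neg q, if_neg (by omega)]; ring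
  have hM3 : 3 ≤ a M + a (M+1) := by
    have b1 := k3 M (by omega) (by omega)
    have b2 := k3 (M+1) (by omega) (by omega)
    have b3 : a M ≠ a (M+1) := fun q => by
      have := k4 M (M+1) (by omega) (by omega) (by omega) (by omega) q
      omega
    omega
  have hnU : ∀ v : Fin (p+1), v ∉ U → v ≠ M ∧ (v:ℕ) ≠ M ∧ ¬ ∃ w ∈ U, (w:ℕ) = v := by
    intro v hv
    have : v ≠ M := by rintro rfl; exact hv hM
    refine ⟨this, fun q => this (Fin.ext q), ?_⟩
    rintro ⟨w, hw, q⟩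
    exact hv (Fin.ext q ▸ hw)
  refine ⟨fun e => decide ((e:ℕ) < (M:ℕ)), fun e => a ((e:ℕ)+1), ?_, ?_, ?_, ?_, ?_, ?_⟩
  · have hinj : Function.Injective (fun e : Fin p => a ((e:ℕ)+1)) := by
      intro e f hef
      have := k4 (e+1) (f+1) (by omega) (by omega) (by omega) (by omega) hef
      exact Fin.ext (by omega)
    have himg : Finset.univ.image (fun e : Fin p => a ((e:ℕ)+1)) = Finset.Icc 1 (p:ℤ) := by
      apply Finset.eq_of_subset_of_card_le
      · intro x hx
        simp only [Finset.mem_image, Finset.mem_univ, true_and] at hx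
        obtain ⟨e, rfl⟩ := hx
        rw [Finset.mem_Icc]
        exact k3 _ (by omega) (by omega)
      · rw [Finset.card_image_of_injective _ hinj]; simp
    refine ⟨fun e _ => k3 _ (by omega) (by omega), hinj.injOn, ?_⟩
    intro x hx
    have : x ∈ Finset.univ.image (fun e : Fin p => a ((e:ℕ)+1)) := by
      rw [himg]; simpa using hx
    simpa using this
  · intro v hv
    by_cases q : v = M
    · rw [q, hsM]; omega
    · rw [hsd v q]
      have := hmax v hv
      have : (v:ℕ) ≠ M := fun q' => q (Fin.ext q')
      exact k5 v (by omega) (by omega) ⟨v, hv, rfl⟩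
  · intro v hv q
    rw [hsd v q]
    have := hmax v hv
    have : (v:ℕ) ≠ M := fun q' => q (Fin.ext q')
    have := hUint v hv
    have b1 := k3 v (by omega) (by omega)
    have b2 := k3 (v+1) (by omega) (by omega)
    rw [plDiff, if_pos (by omega)]
    omega
  · rw [hsM]; exact hM3
  · intro v hv
    obtain ⟨q1, q2, q3⟩ := hnU v hv
    rw [hsd v q1]
    obtain ⟨b1, b2, b3, _⟩ := k6 v (by omega) (by omega) q2 q3
    exact ⟨Int.one_le_abs b3, abs_le.2 ⟨b2, b1⟩⟩
  · intro u v hu hv huv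
    obtain ⟨q1, q2, q3⟩ := hnU u hu
    obtain ⟨r1, r2, r3⟩ := hnU v hv
    rw [hsd u q1, hsd v r1]
    intro h
    exact huv (Fin.ext (k7 u v (by omega) (by omega) q2 q3 (by omega) (by omega) r2 r3 h))
end

section
/- Let k ≥ 2 be an even integer and let a, s be integers with s ≥ 1. Let D be the directed path on vertices x_0, x_1, …, x_k with arcs given by: for each odd j ∈ {1,…,k−1}, an arc from x_j to x_{j−1} and an arc from x_j to x_{j+1}. Define a labeling f of the arcs by: for each even j ∈ {0,…,k−2}, f(x_j x_{j+1}) = a − (j/2)s and f(x_{j+1} x_{j+2}) = a − (k/2 + j/2)s. Then under f the vertex-sums are: s(x_0) = a; s(x_j) = (−1)^j (2a − (k/2 + j − 1)s) for every j ∈ {1,…,k−1}; and s(x_k) = a − (k−1)s. -/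
/-- The vertex-sum of the vertex `x_i` of the directed path `D` on `x_0, x_1, …, x_k`
whose arcs are: for each odd `j`, an arc from `x_j` to `x_{j-1}` and (if `j ≤ k - 1`)
an arc from `x_j` to `x_{j+1}`.  Thus the edge `e` joining `x_e` and `x_{e+1}`
(for `e ∈ {0, …, k-1}`) is directed towards `x_e` when `e` is even and towards
`x_{e+1}` when `e` is odd.  Given an integer labeling `f` of the edges (`f e` being the
label of the edge joining `x_e` and `x_{e+1}`), the vertex-sum of `x_i` is the sum of
the labels of arcs entering `x_i` minus the sum of the labels of arcs leaving `x_i`. -/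
def legVertexSum (k : ℕ) (f : ℕ → ℤ) (i : ℕ) : ℤ :=
  (∑ e ∈ Finset.range k,
      if (e % 2 = 0 ∧ e = i) ∨ (e % 2 = 1 ∧ e + 1 = i) then f e else 0)
  - ∑ e ∈ Finset.range k,
      if (e % 2 = 0 ∧ e + 1 = i) ∨ (e % 2 = 1 ∧ e = i) then f e else 0

theorem leg_aux (k : ℕ) (f : ℕ → ℤ) (i : ℕ) :
    (∑ e ∈ Finset.range k, if e = i ∨ e + 1 = i then f e else 0)
      = (if i < k then f i else 0) + (if 1 ≤ i ∧ i ≤ k then f (i - 1) else 0) := by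
  induction k with
  | zero =>
    have : ¬ (1 ≤ i ∧ i ≤ 0) := by omega
    rw [if_neg this]; simp
  | succ n ih =>
    rw [Finset.sum_range_succ, ih]
    rcases lt_trichotomy i n with h | h | h
    · grind
    · grind
    · by_cases h2 : i = n + 1
      · subst h2; simp
      · grind

theorem leg_even (k : ℕ) (f : ℕ → ℤ) (i : ℕ) (hi : i % 2 = 0) :
    legVertexSum k f i
      = (if i < k then f i else 0) + (if 1 ≤ i ∧ i ≤ k then f (i - 1) else 0) := by
  rw [← leg_aux]
  unfold legVertexSum
  have h2 : (∑ e ∈ Finset.range k,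
      if (e % 2 = 0 ∧ e + 1 = i) ∨ (e % 2 = 1 ∧ e = i) then f e else 0) = 0 :=
    Finset.sum_eq_zero fun e _ => if_neg (by omega)
  rw [h2, sub_zero]
  refine Finset.sum_congr rfl fun e _ => if_congr (by omega) rfl rfl

theorem leg_odd (k : ℕ) (f : ℕ → ℤ) (i : ℕ) (hi : i % 2 = 1) :
    legVertexSum k f i
      = -((if i < k then f i else 0) + (if 1 ≤ i ∧ i ≤ k then f (i - 1) else 0)) := by
  rw [← leg_aux]
  unfold legVertexSum
  have h2 : (∑ e ∈ Finset.range k,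
      if (e % 2 = 0 ∧ e = i) ∨ (e % 2 = 1 ∧ e + 1 = i) then f e else 0) = 0 :=
    Finset.sum_eq_zero fun e _ => if_neg (by omega)
  rw [h2, zero_sub]
  congr 1
  refine Finset.sum_congr rfl fun e _ => if_congr (by omega) rfl rfl

/-- Labeling pattern (I) for a leg of even length `k ≥ 2`: for each even
`j ∈ {0, …, k-2}`, `f(x_j x_{j+1}) = a - (j/2)s` and
`f(x_{j+1} x_{j+2}) = a - (k/2 + j/2)s`.  Then the vertex-sums are `s(x_0) = a`,
`s(x_j) = (-1)^j (2a - (k/2 + j - 1)s)` for `j ∈ {1, …, k-1}`, and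
`s(x_k) = a - (k-1)s`. -/
theorem legVertexSum_pattern_I_even (k : ℕ) (hk : 2 ≤ k) (hke : k % 2 = 0)
    (a s : ℤ) (hs : 1 ≤ s) (f : ℕ → ℤ)
    (hf : ∀ j : ℕ, j % 2 = 0 → j + 2 ≤ k →
      f j = a - ((j : ℤ) / 2) * s ∧
      f (j + 1) = a - ((k : ℤ) / 2 + (j : ℤ) / 2) * s) :
    legVertexSum k f 0 = a ∧
    (∀ j : ℕ, 1 ≤ j → j ≤ k - 1 →
      legVertexSum k f j = (-1 : ℤ) ^ j * (2 * a - ((k : ℤ) / 2 + (j : ℤ) - 1) * s)) ∧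
    legVertexSum k f k = a - ((k : ℤ) - 1) * s := by
  obtain ⟨m, rfl⟩ : ∃ m, k = 2 * m := ⟨k / 2, by omega⟩
  have hg : ∀ t : ℕ, t + 1 ≤ m → f (2 * t) = a - (t : ℤ) * s ∧
      f (2 * t + 1) = a - ((m : ℤ) + t) * s := by
    intro t ht
    have h := hf (2 * t) (by omega) (by omega)
    have e1 : ((2 * t : ℕ) : ℤ) / 2 = t := by omega
    have e2 : ((2 * m : ℕ) : ℤ) / 2 = m := by omega
    rwa [e1, e2] at h
  have e2 : ((2 * m : ℕ) : ℤ) / 2 = m := by omega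
  refine ⟨?_, ?_, ?_⟩
  · rw [leg_even (2 * m) f 0 (by omega), if_pos (by omega), if_neg (by omega)]
    have := (hg 0 (by omega)).1
    simpa using this
  · intro j h1 h2
    rw [e2]
    rcases Nat.even_or_odd' j with ⟨t, rfl | rfl⟩
    · obtain ⟨u, rfl⟩ : ∃ u, t = u + 1 := ⟨t - 1, by omega⟩
      rw [leg_even (2 * m) f (2 * (u + 1)) (by omega), if_pos (by omega), if_pos (by omega),
        (hg (u + 1) (by omega)).1, show 2 * (u + 1) - 1 = 2 * u + 1 by omega,
        (hg u (by omega)).2, pow_mul]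
      push_cast
      norm_num
      ring
    · rw [leg_odd (2 * m) f (2 * t + 1) (by omega), if_pos (by omega), if_pos (by omega),
        (hg t (by omega)).2, show 2 * t + 1 - 1 = 2 * t by omega,
        (hg t (by omega)).1, pow_succ, pow_mul]
      push_cast
      norm_num
      ring
  · obtain ⟨u, rfl⟩ : ∃ u, m = u + 1 := ⟨m - 1, by omega⟩
    rw [leg_even (2 * (u + 1)) f (2 * (u + 1)) (by omega), if_neg (by omega), if_pos (by omega),
      show 2 * (u + 1) - 1 = 2 * u + 1 by omega, (hg u (by omega)).2]
    push_cast
    ring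
end

section
/- Let k ≥ 2 be an even integer and let a, s be integers with s ≥ 1. Let D be the directed path on vertices x_0, x_1, …, x_k with arcs given by: for each odd j ∈ {1,…,k−1}, an arc from x_j to x_{j−1} and an arc from x_j to x_{j+1}. Define a labeling f of the arcs by: for each even j ∈ {0,…,k−2}, f(x_j x_{j+1}) = a − (k−1)s + (k/2 + j/2)s and f(x_{j+1} x_{j+2}) = a − (k−1)s + (j/2)s. Then under f the vertex-sums are: s(x_0) = a − (k/2 − 1)s; s(x_j) = (−1)^j (2a − (3k/2 − 1 − j)s) for every j ∈ {1,…,k−1}; and s(x_k) = a − (k/2)s. -/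
lemma leg_zero (k : ℕ) (hk : 2 ≤ k) (f : ℕ → ℤ) : legVertexSum k f 0 = f 0 := by
  unfold legVertexSum
  rw [Finset.sum_eq_single 0, Finset.sum_eq_zero]
  · simp
  · intro e he
    rw [if_neg (by omega)]
  · intro e he h
    rw [if_neg (by omega)]
  · intro h
    exact absurd (Finset.mem_range.2 (by omega)) h

lemma leg_last (m : ℕ) (f : ℕ → ℤ) :
    legVertexSum (2 * m + 2) f (2 * m + 2) = f (2 * m + 1) := by
  unfold legVertexSum
  rw [Finset.sum_eq_single (2 * m + 1), Finset.sum_eq_zero]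
  · rw [if_pos (by omega)]; simp
  · intro e he
    have := Finset.mem_range.1 he
    rw [if_neg (by omega)]
  · intro e he h
    have := Finset.mem_range.1 he
    rw [if_neg (by omega)]
  · intro h
    exact absurd (Finset.mem_range.2 (by omega)) h

lemma leg_odd_s7 (k t : ℕ) (h : 2 * t + 1 < k) (f : ℕ → ℤ) :
    legVertexSum k f (2 * t + 1) = -(f (2 * t) + f (2 * t + 1)) := by
  unfold legVertexSum
  rw [Finset.sum_eq_zero, Finset.sum_eq_add (2 * t) (2 * t + 1) (by omega)]
  · rw [if_pos (by omega), if_pos (by omega)]; simp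
  · intro e he h
    rw [if_neg (by omega)]
  · intro h
    exact absurd (Finset.mem_range.2 (by omega)) h
  · intro h
    exact absurd (Finset.mem_range.2 (by omega)) h
  · intro e he
    rw [if_neg (by omega)]

lemma leg_even_s7 (k t : ℕ) (h : 2 * t + 2 < k) (f : ℕ → ℤ) :
    legVertexSum k f (2 * t + 2) = f (2 * t + 1) + f (2 * t + 2) := by
  unfold legVertexSum
  rw [Finset.sum_eq_add (2 * t + 1) (2 * t + 2) (by omega), Finset.sum_eq_zero]
  · rw [if_pos (by omega), if_pos (by omega)]; simp
  · intro e he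
    rw [if_neg (by omega)]
  · intro e he h
    rw [if_neg (by omega)]
  · intro h
    exact absurd (Finset.mem_range.2 (by omega)) h
  · intro h
    exact absurd (Finset.mem_range.2 (by omega)) h

/-- Labeling pattern (II) for a leg of even length `k ≥ 2`: for each even
`j ∈ {0, …, k-2}`, `f(x_j x_{j+1}) = a - (k-1)s + (k/2 + j/2)s` and
`f(x_{j+1} x_{j+2}) = a - (k-1)s + (j/2)s`.  Then the vertex-sums are
`s(x_0) = a - (k/2 - 1)s`, `s(x_j) = (-1)^j (2a - (3k/2 - 1 - j)s)` for
`j ∈ {1, …, k-1}`, and `s(x_k) = a - (k/2)s`. -/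
theorem legVertexSum_pattern_II_even (k : ℕ) (hk : 2 ≤ k) (hke : k % 2 = 0)
    (a s : ℤ) (hs : 1 ≤ s) (f : ℕ → ℤ)
    (hf : ∀ j : ℕ, j % 2 = 0 → j + 2 ≤ k →
      f j = a - ((k : ℤ) - 1) * s + ((k : ℤ) / 2 + (j : ℤ) / 2) * s ∧
      f (j + 1) = a - ((k : ℤ) - 1) * s + ((j : ℤ) / 2) * s) :
    legVertexSum k f 0 = a - ((k : ℤ) / 2 - 1) * s ∧
    (∀ j : ℕ, 1 ≤ j → j ≤ k - 1 →
      legVertexSum k f j =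
        (-1 : ℤ) ^ j * (2 * a - (3 * (k : ℤ) / 2 - 1 - (j : ℤ)) * s)) ∧
    legVertexSum k f k = a - ((k : ℤ) / 2) * s := by
  obtain ⟨m, rfl⟩ : ∃ m, k = 2 * m + 2 := ⟨k / 2 - 1, by omega⟩
  have hK : ((2 * m + 2 : ℕ) : ℤ) / 2 = m + 1 := by omega
  have hK3 : 3 * ((2 * m + 2 : ℕ) : ℤ) / 2 = 3 * m + 3 := by omega
  have hF : ∀ t : ℕ, t ≤ m → f (2 * t) = a - (2 * m + 1) * s + (m + 1 + t) * s ∧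
      f (2 * t + 1) = a - (2 * m + 1) * s + t * s := by
    intro t ht
    obtain ⟨h1, h2⟩ := hf (2 * t) (by omega) (by omega)
    have hT : ((2 * t : ℕ) : ℤ) / 2 = t := by omega
    rw [hT] at h1 h2
    rw [hK] at h1
    rw [h1, h2]
    push_cast
    constructor <;> ring
  rw [hK, hK3]
  refine ⟨?_, ?_, ?_⟩
  · rw [leg_zero _ hk]
    have := (hF 0 (by omega)).1
    simp only [mul_zero] at this
    rw [this]
    push_cast
    ring
  · intro j h1 h2
    obtain ⟨t, rfl | rfl⟩ : ∃ t, j = 2 * t + 1 ∨ j = 2 * t + 2 := ⟨(j - 1) / 2, by omega⟩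
    · rw [leg_odd_s7 _ _ (by omega), (hF t (by omega)).1, (hF t (by omega)).2,
        Odd.neg_one_pow ⟨t, rfl⟩]
      push_cast
      ring
    · have h3 := (hF (t + 1) (by omega)).1
      rw [show 2 * (t + 1) = 2 * t + 2 by ring] at h3
      rw [leg_even_s7 _ _ (by omega), (hF t (by omega)).2, h3,
        Even.neg_one_pow ⟨t + 1, by ring⟩]
      push_cast
      ring
  · rw [leg_last, (hF m le_rfl).2]
    ring
end

section
/- Let k ≥ 3 be an odd integer and let a, s be integers with s ≥ 1. Let D be the directed path on vertices x_0, x_1, …, x_k with arcs given by: for each odd j ∈ {1,…,k}, an arc from x_j to x_{j−1}, and additionally an arc from x_j to x_{j+1} whenever j ≤ k−1. Define a labeling f of the arcs by: f(x_{k−1} x_k) = a − ((k−1)/2)s, and for each even j ∈ {0,…,k−3}, f(x_j x_{j+1}) = a − (k−1)s + (j/2)s and f(x_{j+1} x_{j+2}) = a − (k−1)s + ((k+1)/2 + j/2)s. Then under f the vertex-sums are: s(x_0) = a − (k−1)s; s(x_j) = (−1)^j (2a − (3(k−1)/2 − j)s) for every j ∈ {1,…,k−1}; and s(x_k) = −(a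 − ((k−1)/2)s). -/
theorem legVertexSum_closed (k : ℕ) (f : ℕ → ℤ) (i : ℕ) :
    legVertexSum k f i = (if i % 2 = 0 then 1 else -1) *
      ((if i < k then f i else 0) + (if 1 ≤ i ∧ i ≤ k then f (i - 1) else 0)) := by
  induction k with
  | zero =>
    have : ¬ (1 ≤ i ∧ i ≤ 0) := by omega
    rw [if_neg this, if_neg (Nat.not_lt_zero i)]
    simp [legVertexSum]
  | succ k ih =>
    have step : legVertexSum (k + 1) f i = legVertexSum k f i +
        ((if (k % 2 = 0 ∧ k = i) ∨ (k % 2 = 1 ∧ k + 1 = i) then f k else 0) -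
        (if (k % 2 = 0 ∧ k + 1 = i) ∨ (k % 2 = 1 ∧ k = i) then f k else 0)) := by
      simp only [legVertexSum, Finset.sum_range_succ]
      ring
    rw [step, ih]
    by_cases h1 : i = k
    · subst h1
      rcases Nat.mod_two_eq_zero_or_one i with h | h <;> simp [h] <;> split_ifs <;> ring
    · by_cases h2 : i = k + 1
      · subst h2
        rcases Nat.mod_two_eq_zero_or_one k with h | h
        · have h' : (k + 1) % 2 = 1 := by omega
          simp [h, h']
        · have h' : (k + 1) % 2 = 0 := by omega
          simp [h, h']
      · have e1 : (i < k + 1) ↔ i < k := by omega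
        have e2 : (1 ≤ i ∧ i ≤ k + 1) ↔ (1 ≤ i ∧ i ≤ k) := by omega
        have e3 : ¬ k = i := by omega
        have e4 : ¬ k + 1 = i := by omega
        simp only [e1, e2, e3, e4, and_false, or_false, if_false, sub_self, add_zero]

/-- Labeling pattern (III) for a leg of odd length `k ≥ 3`:
`f(x_{k-1} x_k) = a - ((k-1)/2)s`, and for each even `j ∈ {0, …, k-3}`,
`f(x_j x_{j+1}) = a - (k-1)s + (j/2)s` and
`f(x_{j+1} x_{j+2}) = a - (k-1)s + ((k+1)/2 + j/2)s`.  Then the vertex-sums are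
`s(x_0) = a - (k-1)s`, `s(x_j) = (-1)^j (2a - (3(k-1)/2 - j)s)` for
`j ∈ {1, …, k-1}`, and `s(x_k) = -(a - ((k-1)/2)s)`. -/
theorem legVertexSum_pattern_III_odd (k : ℕ) (hk : 3 ≤ k) (hko : k % 2 = 1)
    (a s : ℤ) (hs : 1 ≤ s) (f : ℕ → ℤ)
    (hfk : f (k - 1) = a - (((k : ℤ) - 1) / 2) * s)
    (hf : ∀ j : ℕ, j % 2 = 0 → j + 3 ≤ k →
      f j = a - ((k : ℤ) - 1) * s + ((j : ℤ) / 2) * s ∧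
      f (j + 1) = a - ((k : ℤ) - 1) * s + (((k : ℤ) + 1) / 2 + (j : ℤ) / 2) * s) :
    legVertexSum k f 0 = a - ((k : ℤ) - 1) * s ∧
    (∀ j : ℕ, 1 ≤ j → j ≤ k - 1 →
      legVertexSum k f j =
        (-1 : ℤ) ^ j * (2 * a - (3 * ((k : ℤ) - 1) / 2 - (j : ℤ)) * s)) ∧
    legVertexSum k f k = -(a - (((k : ℤ) - 1) / 2) * s) := by
  obtain ⟨m, rfl⟩ : ∃ m, k = 2 * m + 1 := ⟨k / 2, by omega⟩
  have d1 : (((2 * m + 1 : ℕ) : ℤ) - 1) / 2 = m := by omega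
  have d2 : (((2 * m + 1 : ℕ) : ℤ) + 1) / 2 = m + 1 := by omega
  have d3 : 3 * (((2 * m + 1 : ℕ) : ℤ) - 1) / 2 = 3 * m := by omega
  have d4 : (((2 * m + 1 : ℕ) : ℤ) - 1) = 2 * m := by omega
  rw [d3]
  rw [d1] at hfk ⊢
  simp only [d2] at hf
  rw [d4] at hf ⊢
  have hE : ∀ n : ℕ, n < m → f (2 * n) = a - 2 * m * s + n * s ∧
      f (2 * n + 1) = a - 2 * m * s + (m + 1 + n) * s := by
    intro n hn
    have h := hf (2 * n) (by omega) (by omega)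
    have d : (((2 * n : ℕ) : ℤ)) / 2 = n := by omega
    rwa [d] at h
  have hE' : ∀ n : ℕ, n ≤ m → f (2 * n) = a - 2 * m * s + n * s := by
    intro n hn
    rcases hn.lt_or_eq with h | h
    · exact (hE n h).1
    · subst h
      rw [Nat.add_sub_cancel] at hfk
      rw [hfk]; ring
  refine ⟨?_, ?_, ?_⟩
  · rw [legVertexSum_closed]
    have := hE' 0 (by omega)
    simp at this
    simp [this]
  · intro j h1 h2
    rw [legVertexSum_closed, if_pos (by omega : j < 2 * m + 1),
      if_pos (by omega : 1 ≤ j ∧ j ≤ 2 * m + 1)]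
    rcases Nat.even_or_odd' j with ⟨n, rfl | rfl⟩
    · obtain ⟨n, rfl⟩ : ∃ p, n = p + 1 := ⟨n - 1, by omega⟩
      have e : 2 * (n + 1) - 1 = 2 * n + 1 := by omega
      rw [if_pos (by omega : 2 * (n + 1) % 2 = 0), e, hE' (n + 1) (by omega), (hE n (by omega)).2, pow_mul]
      push_cast
      simp
      ring
    · rw [if_neg (by omega : ¬ (2 * n + 1) % 2 = 0), Nat.add_sub_cancel, hE' n (by omega), (hE n (by omega)).2,
        pow_succ, pow_mul]
      push_cast
      simp
      ring
  · rw [legVertexSum_closed, if_neg (by omega : ¬ (2 * m + 1) % 2 = 0),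
      if_neg (lt_irrefl _), if_pos (by omega : 1 ≤ 2 * m + 1 ∧ 2 * m + 1 ≤ 2 * m + 1), hfk]
    ring
end
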